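/- arXiv:2504.02075 — 4 statements merged into one kernel-verified Lean document; each statement's English description precedes it below -/
import Mathlib

section
/- Let F ∈ ℝ[x, y] be an irreducible polynomial with real zero set C = {(x, y) ∈ ℝ² : F(x, y) = 0}, and assume C ∩ (ℝ \ {0})² ≠ ∅. Suppose there exists (α, β) ∈ (ℝ \ {0})² of infinite order, meaning (α^n, β^n) ≠ (1, 1) for every positive integer n, such that {(αx, βy) : (x, y) ∈ C} = C. Then there exist integers (m, n) ∈ ℤ² with (m, n) ≠ (0, 0) and a real number r ≠ 0 such that every (x, y) ∈ C with x ≠ 0 and y ≠ 0 satisfies x^m y^n = r. In particular, the set {(log|x|, log|y|) : (x, y) ∈ C, x ≠ 0, y ≠ 0} is contained in an affine line of ℝ². -/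
noncomputable section

open MvPolynomial in
/-- The monomial `x^i y^j`. -/
def mon4 (s : Fin 2 →₀ ℕ) : MvPolynomial (Fin 2) ℝ := X 0 ^ s 0 * X 1 ^ s 1

theorem expand4 (F : MvPolynomial (Fin 2) ℝ) :
    F = ∑ s ∈ F.support, MvPolynomial.C (F.coeff s) * mon4 s := by
  conv_lhs => rw [F.as_sum]
  refine Finset.sum_congr rfl fun s _ => ?_
  rw [MvPolynomial.monomial_eq, Finsupp.prod_fintype _ _ (by simp), Fin.prod_univ_two]
  rfl

theorem eval4 (F : MvPolynomial (Fin 2) ℝ) (x y : ℝ) :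
    MvPolynomial.eval ![x, y] F = ∑ s ∈ F.support, F.coeff s * (x ^ s 0 * y ^ s 1) := by
  conv_lhs => rw [expand4 F]
  simp [mon4]

/-- The lattice of relations is cyclic (contained in a cyclic group). -/
theorem lattice4 (α β : ℝ) (hα : α ≠ 0) (hβ : β ≠ 0)
    (hord : ∀ n : ℕ, 0 < n → ¬(α ^ n = 1 ∧ β ^ n = 1)) :
    ∃ m n : ℤ, ¬(m = 0 ∧ n = 0) ∧ ∀ a b : ℤ, α ^ a * β ^ b = 1 →
      ∃ k : ℤ, a = k * m ∧ b = k * n := by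
  have hordz : ∀ n : ℤ, α ^ n = 1 → β ^ n = 1 → n = 0 := by
    intro n h1 h2
    by_contra hn
    refine hord n.natAbs (Int.natAbs_pos.mpr hn) ?_
    rcases Int.natAbs_eq n with h | h
    · rw [h, zpow_natCast] at h1 h2
      exact ⟨h1, h2⟩
    · rw [h, zpow_neg, zpow_natCast, inv_eq_one] at h1 h2
      exact ⟨h1, h2⟩
  have hdet : ∀ a b c d : ℤ, α ^ a * β ^ b = 1 → α ^ c * β ^ d = 1 → a * d - b * c = 0 := by
    intro a b c d h1 h2
    apply hordz
    · have : α ^ (a * d - b * c) = (α ^ a * β ^ b) ^ d * ((α ^ c * β ^ d) ^ b)⁻¹ := by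
        rw [mul_zpow, mul_zpow, zpow_sub₀ hα, ← zpow_mul, ← zpow_mul, ← zpow_mul, ← zpow_mul,
          mul_comm c b, mul_comm d b]
        field_simp
      rw [this, h1, h2]; simp
    · have : β ^ (a * d - b * c) = (α ^ c * β ^ d) ^ a * ((α ^ a * β ^ b) ^ c)⁻¹ := by
        rw [mul_zpow, mul_zpow, zpow_sub₀ hβ, ← zpow_mul, ← zpow_mul, ← zpow_mul, ← zpow_mul,
          mul_comm c a, mul_comm d a]
        field_simp
      rw [this, h1, h2]; simp
  let L : AddSubgroup (ℤ × ℤ) :=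
    { carrier := {p | α ^ p.1 * β ^ p.2 = 1}
      zero_mem' := by simp
      add_mem' := by
        intro p q hp hq
        simp only [Set.mem_ofPred_eq, Prod.fst_add, Prod.snd_add] at *
        rw [zpow_add₀ hα, zpow_add₀ hβ, mul_mul_mul_comm, hp, hq, one_mul]
      neg_mem' := by
        intro p hp
        simp only [Set.mem_ofPred_eq, Prod.fst_neg, Prod.snd_neg] at *
        rw [zpow_neg, zpow_neg, ← mul_inv, hp, inv_one] }
  have hL : ∀ a b : ℤ, (a, b) ∈ L ↔ α ^ a * β ^ b = 1 := fun a b => Iff.rfl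
  by_cases h : ∃ a b : ℤ, α ^ a * β ^ b = 1 ∧ a ≠ 0
  · obtain ⟨a0, b0, h0, ha0⟩ := h
    obtain ⟨g, hg⟩ := Int.subgroup_cyclic (L.map (AddMonoidHom.fst ℤ ℤ))
    have hgm : g ∈ L.map (AddMonoidHom.fst ℤ ℤ) := by
      rw [hg]; exact AddSubgroup.subset_closure rfl
    obtain ⟨⟨m, n⟩, hmn, rfl⟩ := hgm
    have key : ∀ a b : ℤ, α ^ a * β ^ b = 1 → ∃ k : ℤ, a = k * m := by
      intro a b hab
      have : a ∈ L.map (AddMonoidHom.fst ℤ ℤ) := ⟨(a, b), hab, rfl⟩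
      rw [hg, AddSubgroup.mem_closure_singleton] at this
      obtain ⟨k, hk⟩ := this
      exact ⟨k, by simpa using hk.symm⟩
    have hm : m ≠ 0 := by
      rintro rfl
      obtain ⟨k, hk⟩ := key a0 b0 h0
      simp at hk; exact ha0 hk
    refine ⟨m, n, fun h => hm h.1, fun a b hab => ?_⟩
    obtain ⟨k, hk⟩ := key a b hab
    refine ⟨k, hk, ?_⟩
    have := hdet m n a b hmn hab
    rw [hk] at this
    apply mul_left_cancel₀ hm
    linarith
  · push Not at h
    obtain ⟨g, hg⟩ := Int.subgroup_cyclic (L.map (AddMonoidHom.snd ℤ ℤ))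
    have key : ∀ a b : ℤ, α ^ a * β ^ b = 1 → ∃ k : ℤ, b = k * g := by
      intro a b hab
      have : b ∈ L.map (AddMonoidHom.snd ℤ ℤ) := ⟨(a, b), hab, rfl⟩
      rw [hg, AddSubgroup.mem_closure_singleton] at this
      obtain ⟨k, hk⟩ := this
      exact ⟨k, by simpa using hk.symm⟩
    by_cases hg0 : g = 0
    · refine ⟨0, 1, by simp, fun a b hab => ⟨b, by simpa using h a b hab, by simp⟩⟩
    · refine ⟨0, g, by simpa using hg0, fun a b hab => ?_⟩
      obtain ⟨k, hk⟩ := key a b hab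
      exact ⟨k, by simpa using h a b hab, hk⟩

/-- Separation of the exponentials. -/
theorem separate4 {ι : Type*} (S : Finset ι) (c l : ι → ℝ)
    (h : ∀ k : ℕ, ∑ s ∈ S, c s * l s ^ k = 0) (μ : ℝ) :
    ∑ s ∈ S with l s = μ, c s = 0 := by
  classical
  have hp : ∀ p : Polynomial ℝ, ∑ s ∈ S, c s * p.eval (l s) = 0 := by
    intro p
    induction p using Polynomial.induction_on' with
    | add p q hp hq => simp [mul_add, Finset.sum_add_distrib, hp, hq]
    | monomial n a =>
      simp only [Polynomial.eval_monomial]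
      have := congrArg (a * ·) (h n)
      simp only [Finset.mul_sum, mul_zero] at this
      rw [← this]
      exact Finset.sum_congr rfl fun s _ => by ring
  let p : Polynomial ℝ := ∏ ν ∈ (S.image l).erase μ, (Polynomial.X - Polynomial.C ν)
  have h1 : p.eval μ ≠ 0 := by
    simp only [p, Polynomial.eval_prod, Finset.prod_ne_zero_iff]
    intro ν hν
    simp only [Polynomial.eval_sub, Polynomial.eval_X, Polynomial.eval_C]
    exact sub_ne_zero.mpr (Finset.ne_of_mem_erase hν).symm
  have h2 : ∀ s ∈ S, l s ≠ μ → p.eval (l s) = 0 := by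
    intro s hs hne
    simp only [p, Polynomial.eval_prod]
    exact Finset.prod_eq_zero (Finset.mem_erase.mpr ⟨hne, Finset.mem_image_of_mem l hs⟩) (by simp)
  have h3 : (∑ s ∈ S with l s = μ, c s) * p.eval μ = 0 := by
    rw [← hp p, Finset.sum_mul, Finset.sum_filter]
    refine Finset.sum_congr rfl fun s hs => ?_
    split_ifs with hh
    · rw [hh]
    · rw [h2 s hs hh, mul_zero]
  exact (mul_eq_zero.mp h3).resolve_right h1

/-- `f` is divisible by `B` up to factors not vanishing at `v`. -/
def I4 (v : Fin 2 → ℝ) (B : MvPolynomial (Fin 2) ℝ) : Ideal (MvPolynomial (Fin 2) ℝ) where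
  carrier := {f | ∃ M, MvPolynomial.eval v M ≠ 0 ∧ B ∣ M * f}
  zero_mem' := ⟨1, by simp, by simp⟩
  add_mem' := by
    rintro f g ⟨M, hM, h⟩ ⟨N, hN, h'⟩
    refine ⟨M * N, by simp [hM, hN], ?_⟩
    have : M * N * (f + g) = N * (M * f) + M * (N * g) := by ring
    rw [this]
    exact dvd_add (h.mul_left _) (h'.mul_left _)
  smul_mem' := by
    rintro c f ⟨M, hM, h⟩
    refine ⟨M, hM, ?_⟩
    rw [smul_eq_mul, mul_left_comm]
    exact h.mul_left _

theorem binom4 (x y : ℝ) (hx : x ≠ 0) (hy : y ≠ 0) (U V : MvPolynomial (Fin 2) ℝ)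
    (p q p' q' k : ℕ)
    (hU : U = MvPolynomial.X 0 ^ p * MvPolynomial.X 1 ^ q)
    (hV : V = MvPolynomial.X 0 ^ p' * MvPolynomial.X 1 ^ q')
    (s t : Fin 2 →₀ ℕ) (h0 : s 0 + k * p' = t 0 + k * p) (h1 : s 1 + k * q' = t 1 + k * q) :
    MvPolynomial.C (x ^ t 0 * y ^ t 1) * mon4 s - MvPolynomial.C (x ^ s 0 * y ^ s 1) * mon4 t ∈
      I4 ![x, y] (MvPolynomial.C (x ^ p' * y ^ q') * U - MvPolynomial.C (x ^ p * y ^ q) * V) := by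
  refine ⟨V ^ k * MvPolynomial.C ((x ^ p' * y ^ q') ^ k), by subst hV; simp [hx, hy], ?_⟩
  have e1 : V ^ k * mon4 s = U ^ k * mon4 t := by
    subst hU hV
    simp only [mon4, mul_pow, ← pow_mul]
    have a0 : (MvPolynomial.X 0 : MvPolynomial (Fin 2) ℝ) ^ (s 0 + k * p') =
      MvPolynomial.X 0 ^ (t 0 + k * p) := by rw [h0]
    have a1 : (MvPolynomial.X 1 : MvPolynomial (Fin 2) ℝ) ^ (s 1 + k * q') =
      MvPolynomial.X 1 ^ (t 1 + k * q) := by rw [h1]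
    rw [pow_add, pow_add, mul_comm k, mul_comm k] at a0 a1
    linear_combination (MvPolynomial.X 1 ^ (s 1) * MvPolynomial.X 1 ^ (q' * k)) * a0 +
      (MvPolynomial.X 0 ^ (t 0) * MvPolynomial.X 0 ^ (p * k)) * a1
  have e2 : (x ^ p' * y ^ q') ^ k * (x ^ s 0 * y ^ s 1) =
      (x ^ p * y ^ q) ^ k * (x ^ t 0 * y ^ t 1) := by
    have := congrArg (MvPolynomial.eval ![x, y]) e1
    subst hU hV
    simpa [mon4] using this
  have e3 := congrArg (MvPolynomial.C (σ := Fin 2)) e2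
  have hd := (sub_dvd_pow_sub_pow (MvPolynomial.C (x ^ p' * y ^ q') * U)
    (MvPolynomial.C (x ^ p * y ^ q) * V) k).mul_left
      (MvPolynomial.C (x ^ t 0 * y ^ t 1) * mon4 t)
  convert hd using 1
  simp only [map_mul, map_pow, mul_pow] at e3 ⊢
  linear_combination ((MvPolynomial.C x ^ p') ^ k * (MvPolynomial.C y ^ q') ^ k *
      (MvPolynomial.C x ^ t 0 * MvPolynomial.C y ^ t 1)) * e1
    - V ^ k * mon4 t * e3

theorem stmt4 (F : MvPolynomial (Fin 2) ℝ) (hF : Irreducible F)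
    (C : Set (ℝ × ℝ))
    (hC : C = {z : ℝ × ℝ | MvPolynomial.eval ![z.1, z.2] F = 0})
    (hne : ∃ z ∈ C, z.1 ≠ 0 ∧ z.2 ≠ 0)
    (α β : ℝ) (hα : α ≠ 0) (hβ : β ≠ 0)
    (hord : ∀ n : ℕ, 0 < n → ¬(α ^ n = 1 ∧ β ^ n = 1))
    (hinv : (fun z : ℝ × ℝ => (α * z.1, β * z.2)) '' C = C) :
    ∃ m n : ℤ, ¬(m = 0 ∧ n = 0) ∧ ∃ r : ℝ, r ≠ 0 ∧
      (∀ z ∈ C, z.1 ≠ 0 → z.2 ≠ 0 → z.1 ^ m * z.2 ^ n = r) ∧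
      ∃ a b γ : ℝ, ¬(a = 0 ∧ b = 0) ∧
        ∀ z ∈ C, z.1 ≠ 0 → z.2 ≠ 0 →
          a * Real.log |z.1| + b * Real.log |z.2| = γ := by
  classical
  obtain ⟨m, n, hmn, hlat⟩ := lattice4 α β hα hβ hord
  obtain ⟨⟨x, y⟩, hz, hx, hy⟩ := hne
  simp only at hx hy
  refine ⟨m, n, hmn, x ^ m * y ^ n, mul_ne_zero (zpow_ne_zero _ hx) (zpow_ne_zero _ hy), ?_⟩
  suffices H : ∀ z ∈ C, z.1 ≠ 0 → z.2 ≠ 0 → z.1 ^ m * z.2 ^ n = x ^ m * y ^ n by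
    refine ⟨H, m, n, Real.log |x ^ m * y ^ n|, by exact_mod_cast hmn, fun z hz h1 h2 => ?_⟩
    rw [← H z hz h1 h2, Real.log_abs, Real.log_abs, Real.log_abs,
      Real.log_mul (zpow_ne_zero _ h1) (zpow_ne_zero _ h2), Real.log_zpow, Real.log_zpow]
  -- the orbit
  have horb : ∀ k : ℕ, (α ^ k * x, β ^ k * y) ∈ C := by
    intro k
    induction k with
    | zero => simpa using hz
    | succ k ih =>
      rw [← hinv]
      exact ⟨_, ih, by simp only [pow_succ']; ext <;> simp <;> ring⟩
  have hsep := separate4 F.support (fun s => F.coeff s * (x ^ s 0 * y ^ s 1))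
    (fun s => α ^ s 0 * β ^ s 1) (by
      intro k
      have := horb k
      rw [hC, Set.mem_ofPred_eq, eval4] at this
      rw [← this]
      refine Finset.sum_congr rfl fun s _ => ?_
      simp only
      ring)
  obtain ⟨p, p', hpm⟩ : ∃ p p' : ℕ, m = p - p' := ⟨m.toNat, (-m).toNat, by omega⟩
  obtain ⟨q, q', hqn⟩ : ∃ q q' : ℕ, n = q - q' := ⟨n.toNat, (-n).toNat, by omega⟩
  obtain ⟨U, hU⟩ : ∃ U : MvPolynomial (Fin 2) ℝ,
    U = MvPolynomial.X 0 ^ p * MvPolynomial.X 1 ^ q := ⟨_, rfl⟩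
  obtain ⟨V, hV⟩ : ∃ V : MvPolynomial (Fin 2) ℝ,
    V = MvPolynomial.X 0 ^ p' * MvPolynomial.X 1 ^ q' := ⟨_, rfl⟩
  obtain ⟨B, hB⟩ : ∃ B, B = MvPolynomial.C (x ^ p' * y ^ q') * U -
    MvPolynomial.C (x ^ p * y ^ q) * V := ⟨_, rfl⟩
  have hpair : ∀ s t : Fin 2 →₀ ℕ, α ^ s 0 * β ^ s 1 = α ^ t 0 * β ^ t 1 →
      MvPolynomial.C (x ^ t 0 * y ^ t 1) * mon4 s - MvPolynomial.C (x ^ s 0 * y ^ s 1) * mon4 t ∈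
        I4 ![x, y] B := by
    intro s t hst
    obtain ⟨k, hk0, hk1⟩ := hlat ((s 0 : ℤ) - t 0) ((s 1 : ℤ) - t 1) (by
      rw [zpow_sub₀ hα, zpow_sub₀ hβ]
      simp only [zpow_natCast]
      rw [div_mul_div_comm, hst, div_self]
      exact mul_ne_zero (pow_ne_zero _ hα) (pow_ne_zero _ hβ))
    rw [hpm] at hk0
    rw [hqn] at hk1
    rw [hB]
    rcases Int.eq_nat_or_neg k with ⟨k, rfl | rfl⟩
    · refine binom4 x y hx hy U V p q p' q' k hU hV s t ?_ ?_
      · zify; linarith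
      · zify; linarith
    · rw [← neg_mem_iff, neg_sub]
      refine binom4 x y hx hy U V p q p' q' k hU hV t s ?_ ?_
      · zify; linarith
      · zify; linarith
  have hFI : F ∈ I4 ![x, y] B := by
    rw [expand4 F, ← Finset.sum_fiberwise_of_maps_to (t := F.support.image
      fun s => α ^ s 0 * β ^ s 1) (g := fun s => α ^ s 0 * β ^ s 1)
      (fun s hs => Finset.mem_image_of_mem _ hs)]
    refine sum_mem fun μ hμ => ?_
    obtain ⟨t, ht, rfl⟩ := Finset.mem_image.mp hμ
    have hs := hsep (α ^ t 0 * β ^ t 1)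
    have hw : x ^ t 0 * y ^ t 1 ≠ 0 := mul_ne_zero (pow_ne_zero _ hx) (pow_ne_zero _ hy)
    have hI : ∑ s ∈ F.support with α ^ s 0 * β ^ s 1 = α ^ t 0 * β ^ t 1,
        MvPolynomial.C (F.coeff s) * (MvPolynomial.C (x ^ t 0 * y ^ t 1) * mon4 s
          - MvPolynomial.C (x ^ s 0 * y ^ s 1) * mon4 t) ∈ I4 ![x, y] B :=
      sum_mem fun s hs => Ideal.mul_mem_left _ _ (hpair s t (Finset.mem_filter.mp hs).2)
    have hs' := congrArg (MvPolynomial.C (σ := Fin 2)) hs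
    rw [map_sum, MvPolynomial.C_0] at hs'
    have := Ideal.mul_mem_left _ (MvPolynomial.C (x ^ t 0 * y ^ t 1)⁻¹) hI
    convert this using 1
    simp only [mul_sub, Finset.sum_sub_distrib]
    have z1 : ∑ s ∈ F.support with α ^ s 0 * β ^ s 1 = α ^ t 0 * β ^ t 1,
        MvPolynomial.C (F.coeff s) * (MvPolynomial.C (x ^ s 0 * y ^ s 1) * mon4 t) = 0 := by
      simp only [← mul_assoc, ← Finset.sum_mul]
      simp only [← MvPolynomial.C_mul]
      rw [hs', zero_mul]
    rw [z1, mul_zero, sub_zero, Finset.mul_sum]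
    refine Finset.sum_congr rfl fun s _ => ?_
    have : (MvPolynomial.C (x ^ t 0 * y ^ t 1)⁻¹ : MvPolynomial (Fin 2) ℝ) *
      MvPolynomial.C (x ^ t 0 * y ^ t 1) = 1 := by
      rw [← MvPolynomial.C_mul, inv_mul_cancel₀ hw, MvPolynomial.C_1]
    linear_combination (-(MvPolynomial.C (F.coeff s) * mon4 s)) * this
  obtain ⟨M, hM, Q, hQ⟩ := hFI
  have hdvd : F ∣ B := by
    have hFp : Prime F := hF.prime
    rcases hFp.dvd_or_dvd (show F ∣ B * Q from hQ ▸ Dvd.intro_left M rfl) with h | ⟨Q', rfl⟩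
    · exact h
    · exfalso
      have : M = B * Q' := by
        apply mul_right_cancel₀ hFp.ne_zero
        rw [hQ]; ring
      apply hM
      rw [this, hB, hU, hV]
      simp
      left; ring
  rintro ⟨u, v⟩ huv hu hv
  simp only at hu hv ⊢
  rw [hC, Set.mem_ofPred_eq] at huv
  simp only at huv
  have hBz : MvPolynomial.eval ![u, v] B = 0 := by
    obtain ⟨G, rfl⟩ := hdvd
    rw [map_mul, huv, zero_mul]
  rw [hB, hU, hV] at hBz
  simp at hBz
  rw [hpm, hqn, zpow_sub₀ hu, zpow_sub₀ hv, zpow_sub₀ hx, zpow_sub₀ hy]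
  simp only [zpow_natCast]
  field_simp
  linear_combination hBz
end
end

section
/- Let δ ≥ 1 and let p(x), q(x) ∈ ℝ[x] be polynomials of degree at most δ. Let f and g each be either the function x ↦ log|x| or the identity function on ℝ. Define C = {(f(p(t)), g(q(t))) : t ∈ ℝ}, restricting to those t for which the expressions are defined (i.e., requiring p(t) ≠ 0 when f = log|·| and q(t) ≠ 0 when g = log|·|). Assume C is not contained in any affine line of ℝ². Then for every nonzero vector a ∈ ℝ², the intersection (C + a) ∩ C contains at most 16δ² points, where C + a := {z + a : z ∈ C}. -/
open Polynomial

/-- evaluation of a bivariate polynomial at a pair of polynomials -/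
noncomputable def bev (E : ℝ[X][X]) (p q : ℝ[X]) : ℝ[X] := E.eval₂ (compRingHom q) p

lemma bev_eval (E : ℝ[X][X]) (p q : ℝ[X]) (s : ℝ) :
    (bev E p q).eval s = (E.map (evalRingHom (q.eval s))).eval (p.eval s) := by
  unfold bev
  rw [eval_map, ← coe_evalRingHom, Polynomial.hom_eval₂]
  congr 1
  ext x <;> simp

lemma bev_natDegree (E : ℝ[X][X]) (p q : ℝ[X]) (δ D : ℕ) (hp : p.natDegree ≤ δ)
    (hq : q.natDegree ≤ δ) (hE : E.natDegree ≤ D) (hE' : ∀ i, (E.coeff i).natDegree ≤ D) :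
    (bev E p q).natDegree ≤ 2 * D * δ := by
  unfold bev
  rw [eval₂_eq_sum_range]
  apply natDegree_sum_le_of_forall_le
  intro i hi
  have hi' : i ≤ D := by
    have := Finset.mem_range.1 hi
    omega
  refine natDegree_mul_le.trans ?_
  have h1 : ((compRingHom q) (E.coeff i)).natDegree ≤ D * δ := by
    simp only [coe_compRingHom_apply]
    exact natDegree_comp_le.trans (Nat.mul_le_mul (hE' i) hq)
  have h2 : (p ^ i).natDegree ≤ D * δ := natDegree_pow_le.trans (Nat.mul_le_mul hi' hp)
  calc _ ≤ D * δ + D * δ := add_le_add h1 h2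
    _ = _ := by ring

lemma exists_bev_zero (p q : ℝ[X]) (δ : ℕ) (hδ : 1 ≤ δ) (hp : p.natDegree ≤ δ)
    (hq : q.natDegree ≤ δ) : ∃ E : ℝ[X][X], E ≠ 0 ∧ E.natDegree ≤ 2 * δ ∧
      (∀ i, (E.coeff i).natDegree ≤ 2 * δ) ∧ bev E p q = 0 := by
  let D := 2 * δ
  let B : (Fin (D+1) → Fin (D+1) → ℝ) → ℝ[X][X] := fun c =>
    ∑ i : Fin (D+1), monomial i (∑ j : Fin (D+1), monomial j (c i j))
  have hBc : ∀ c (i j : Fin (D+1)), ((B c).coeff i).coeff j = c i j := by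
    intro c i j
    simp [B, coeff_monomial, Fin.val_inj]
  have hBd : ∀ c, (B c).natDegree ≤ D := by
    intro c
    apply natDegree_sum_le_of_forall_le
    intro i _
    exact (natDegree_monomial_le _).trans (by omega)
  have hBd' : ∀ c i, ((B c).coeff i).natDegree ≤ D := by
    intro c i
    simp only [B, finsetSum_coeff]
    apply natDegree_sum_le_of_forall_le
    intro k _
    rw [coeff_monomial]
    split_ifs
    · apply natDegree_sum_le_of_forall_le
      intro i _
      exact (natDegree_monomial_le _).trans (by omega)
    · simp
  let L : (Fin (D+1) → Fin (D+1) → ℝ) →ₗ[ℝ] degreeLT ℝ (2 * D * δ + 1) :=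
    { toFun := fun c => ⟨bev (B c) p q, by
        rw [mem_degreeLT]
        have := bev_natDegree (B c) p q δ D hp hq (hBd c) (hBd' c)
        exact lt_of_le_of_lt degree_le_natDegree (by exact_mod_cast Nat.lt_succ_of_le this)⟩
      map_add' := by
        intro c d
        apply Subtype.ext
        have : B (c + d) = B c + B d := by
          simp [B, Finset.sum_add_distrib, map_add]
        simp [this, bev, eval₂_add]
      map_smul' := by
        intro r c
        apply Subtype.ext
        have : B (r • c) = C (C r) * B c := by
          simp [B, Finset.mul_sum, C_mul_monomial]
        simp [this, bev, eval₂_mul, smul_eq_C_mul] }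
  have hk : LinearMap.ker L ≠ ⊥ := by
    apply LinearMap.ker_ne_bot_of_finrank_lt
    rw [LinearEquiv.finrank_eq (degreeLTEquiv ℝ _)]
    simp only [Module.finrank_pi_fintype, Module.finrank_self, Finset.sum_const, Finset.card_univ, Fintype.card_fin, smul_eq_mul, D]
    nlinarith
  obtain ⟨c, hc, hc0⟩ := (Submodule.ne_bot_iff _).1 hk
  refine ⟨B c, ?_, hBd c, hBd' c, ?_⟩
  · intro h
    apply hc0
    ext i j
    rw [← hBc c i j, h]; simp
  · have := LinearMap.mem_ker.1 hc
    exact congrArg Subtype.val this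

lemma core (p q : ℝ[X]) (δ : ℕ) (hδ : 1 ≤ δ) (hp : p.natDegree ≤ δ)
    (hq : q.natDegree ≤ δ) (l m b : ℝ) :
    (∃ T : Finset ℝ, T.card ≤ 4 * δ ^ 2 ∧ ∀ s t, p.eval t = l * p.eval s →
      q.eval t = m * q.eval s + b → s ∈ T) ∨
    (∃ E : ℝ[X][X], bev E p q = 0 ∧ ∃ i0 j0, (E.coeff i0).coeff j0 ≠ 0 ∧
      ∀ i, C (l ^ i) * (E.coeff i).comp (C m * X + C b) = C (l ^ i0 * m ^ j0) * E.coeff i) := by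
  by_contra! hcon
  obtain ⟨hT, hcon⟩ := hcon
  have hR : ∀ R : ℝ[X], R.natDegree ≤ 4 * δ ^ 2 → (∀ s t, p.eval t = l * p.eval s →
      q.eval t = m * q.eval s + b → R.eval s = 0) → R = 0 := by
    intro R hd hs
    by_contra h0
    obtain ⟨s, t, h1, h2, h3⟩ := hT R.roots.toFinset
      ((Multiset.toFinset_card_le _).trans ((card_roots' R).trans hd))
    apply h3
    simp [h0, hs s t h1 h2]
  let S : Set ℝ[X][X] := {E | E ≠ 0 ∧ E.natDegree ≤ 2 * δ ∧
      (∀ i, (E.coeff i).natDegree ≤ 2 * δ) ∧ bev E p q = 0}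
  have hS : S.Nonempty := exists_bev_zero p q δ hδ hp hq
  let M : ℝ[X][X] → ℕ := fun E => E.natDegree * (2 * δ + 1) + E.leadingCoeff.natDegree
  obtain ⟨E, hES, hmin⟩ : ∃ E ∈ S, ∀ E' ∈ S, M E ≤ M E' := by
    obtain ⟨E, h1, h2⟩ := (InvImage.wf M Nat.lt_wfRel.wf).has_min S hS
    exact ⟨E, h1, fun E' h => not_lt.1 (h2 E' h)⟩
  obtain ⟨hE0, hEd, hEd', hEz⟩ := hES
  set n := E.natDegree with hn
  set j := E.leadingCoeff.natDegree with hj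
  let F := (E.map (compRingHom (C m * X + C b))).comp (C (C l) * X)
  have hFc : ∀ i, F.coeff i = C (l ^ i) * (E.coeff i).comp (C m * X + C b) := by
    intro i
    simp only [F, comp_C_mul_X_coeff, coeff_map, coe_compRingHom_apply, C_pow]
    exact mul_comm _ _
  have hℓ : (C m * X + C b : ℝ[X]).natDegree ≤ 1 := natDegree_linear_le
  have hFd : ∀ i, (F.coeff i).natDegree ≤ (E.coeff i).natDegree := by
    intro i
    rw [hFc]
    refine (natDegree_C_mul_le _ _).trans (natDegree_comp_le.trans ?_)
    nlinarith
  let E' := F - C (C (l ^ n * m ^ j)) * E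
  have hEc : ∀ i, E'.coeff i = F.coeff i - C (l ^ n * m ^ j) * E.coeff i := by
    intro i; simp only [E', coeff_sub, coeff_C_mul]
  have hE'd : ∀ i, (E'.coeff i).natDegree ≤ (E.coeff i).natDegree := by
    intro i
    rw [hEc]
    exact (natDegree_sub_le_of_le (hFd i) (natDegree_C_mul_le _ _)).trans (max_self _).le
  have hE'n : E'.natDegree ≤ n := by
    rw [natDegree_le_iff_coeff_eq_zero]
    intro N hN
    rw [hEc, hFc, coeff_eq_zero_of_natDegree_lt hN]
    simp
  have hbF : bev F p q = 0 := by
    apply hR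
    · have hFn : F.natDegree ≤ n := by
        rw [natDegree_le_iff_coeff_eq_zero]
        intro N hN
        rw [hFc, coeff_eq_zero_of_natDegree_lt hN]
        simp
      refine (bev_natDegree F p q δ (2 * δ) hp hq (hFn.trans hEd)
        (fun i => (hFd i).trans (hEd' i))).trans (le_of_eq (by ring))
    · intro s t h1 h2
      have h3 : (bev E p q).eval t = 0 := by rw [hEz]; simp
      rw [bev_eval, h1, h2] at h3
      rw [bev_eval, ← h3]
      have : (evalRingHom (eval s q)).comp (compRingHom (C m * X + C b)) =
          evalRingHom (m * eval s q + b) := by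
        ext <;> simp
      simp [F, map_comp, map_map, this]
  have hbE' : bev E' p q = 0 := by
    have : bev E' p q = bev F p q - C (l ^ n * m ^ j) * bev E p q := by
      simp only [bev, E', eval₂_sub, eval₂_mul, eval₂_C, coe_compRingHom_apply, C_comp]
    rw [this, hbF, hEz]; simp
  have hE'0 : E' = 0 := by
    by_contra h0
    have hM := hmin E' ⟨h0, hE'n.trans hEd, fun i => (hE'd i).trans (hEd' i), hbE'⟩
    have hcj : (E'.coeff n).coeff j = 0 := by
      rw [hEc, hFc, coeff_sub, coeff_C_mul, coeff_C_mul]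
      have : ((E.coeff n).comp (C m * X + C b)).coeff j = m ^ j * (E.coeff n).coeff j := by
        by_cases hm : m = 0
        · subst hm
          by_cases hj0 : j = 0
          · have h := natDegree_eq_zero.1 (hj.symm.trans hj0)
            obtain ⟨x, hx⟩ := h
            have : E.coeff n = C x := hx.symm
            rw [this]; simp [hj0]
          · simp [hj0, coeff_C]
        · have h1 : (C m * X + C b : ℝ[X]).natDegree = 1 := natDegree_linear hm
          have := coeff_comp_degree_mul_degree (p := E.coeff n) (q := C m * X + C b) (by rw [h1]; simp)
          rw [h1, mul_one, leadingCoeff_linear hm] at this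
          rw [show j = (E.coeff n).natDegree from rfl, this, mul_comm]; rfl
      rw [this]; ring
    simp only [M, ← hn, ← hj] at hM
    have hld : E'.leadingCoeff.natDegree ≤ 2 * δ := (hE'd _).trans (hEd' _)
    rcases hE'n.lt_or_eq with h | h
    · have : E'.natDegree * (2 * δ + 1) + (2 * δ + 1) ≤ n * (2 * δ + 1) := by nlinarith
      omega
    · have h1 : E'.leadingCoeff = E'.coeff n := by rw [leadingCoeff, h]
      have h2 : E'.coeff n ≠ 0 := by rw [← h1]; exact leadingCoeff_ne_zero.2 h0
      rw [h1, h] at hM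
      have h3 : j ≤ (E'.coeff n).natDegree := by omega
      have h4 : (E'.coeff n).natDegree = j := le_antisymm (hE'd n) h3
      apply h2
      rw [← leadingCoeff_eq_zero, leadingCoeff, h4, hcj]
  obtain ⟨i, hi⟩ := hcon E hEz n j (by
    show E.leadingCoeff.leadingCoeff ≠ 0
    simpa using hE0)
  apply hi
  have := hEc i
  rw [hE'0, hFc] at this
  simpa [sub_eq_zero] using this.symm

lemma const_of_comp_eq_zero (e p : ℝ[X]) (he : e ≠ 0) (h : e.comp p = 0) : p.natDegree = 0 := by
  by_contra h0
  rcases comp_eq_zero_iff.1 h with h | h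
  · exact he h
  · apply h0
    rw [h.2]; simp

lemma const_of_periodic (e : ℝ[X]) (b : ℝ) (hb : b ≠ 0) (h : e.comp (X + C b) = e) :
    e = C (e.eval 0) := by
  have hn : ∀ n : ℕ, e.eval (n * b) = e.eval 0 := by
    intro n
    induction n with
    | zero => simp
    | succ k ih =>
      rw [← ih]
      conv_rhs => rw [← h]
      simp only [eval_comp, eval_add, eval_X, eval_C]
      congr 1; push_cast; ring
  apply eq_of_infinite_eval_eq
  have hinj : Function.Injective (fun n : ℕ => (n : ℝ) * b) := by
    intro x y hxy
    exact_mod_cast mul_right_cancel₀ hb hxy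
  refine (Set.infinite_range_of_injective hinj).mono ?_
  rintro _ ⟨n, rfl⟩
  simp [hn]

lemma bev_single (E : ℝ[X][X]) (p q : ℝ[X]) (i0 : ℕ) (h0 : E.coeff i0 ≠ 0)
    (h : ∀ i, E.coeff i ≠ 0 → i = i0) (hb : bev E p q = 0) :
    p.natDegree = 0 ∨ q.natDegree = 0 := by
  have hE : E = monomial i0 (E.coeff i0) := by
    ext1 i
    rw [coeff_monomial]
    split_ifs with hi
    · rw [hi]
    · by_contra h1
      exact hi (h i h1).symm
  rw [hE, bev, eval₂_monomial, mul_eq_zero] at hb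
  rcases hb with hb | hb
  · right
    exact const_of_comp_eq_zero _ _ h0 hb
  · left
    have hb' : p = 0 := by by_contra h1; exact pow_ne_zero _ h1 hb
    simp [hb']

lemma core1 (p q : ℝ[X]) (δ : ℕ) (hδ : 1 ≤ δ) (hp : p.natDegree ≤ δ)
    (hq : q.natDegree ≤ δ) (l b : ℝ) (hl : l ≠ 0) (h : ¬ (Real.log |l| = 0 ∧ b = 0))
    (hp0 : p.natDegree ≠ 0) (hq0 : q.natDegree ≠ 0 ∨ b ≠ 0) :
    (∃ T : Finset ℝ, T.card ≤ 4 * δ ^ 2 ∧ ∀ s t, p.eval t = l * p.eval s →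
      q.eval t = q.eval s + b → s ∈ T) := by
  rcases core p q δ hδ hp hq l 1 b with hT | ⟨E, hE, i0, j0, hc, hi⟩
  · simpa using hT
  exfalso
  simp only [C_1, one_mul, one_pow, mul_one] at hi
  have hc0 : E.coeff i0 ≠ 0 := by
    intro h; simp [h] at hc
  have hpow : ∀ i, E.coeff i ≠ 0 → l ^ i = l ^ i0 := by
    intro i h0
    have h1 := congrArg leadingCoeff (hi i)
    rw [leadingCoeff_mul, leadingCoeff_mul, leadingCoeff_comp (by simp)] at h1
    simp only [leadingCoeff_C, leadingCoeff_X_add_C, one_pow, mul_one] at h1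
    exact mul_right_cancel₀ (leadingCoeff_ne_zero.2 h0) h1
  by_cases hb : b = 0
  · have hll : Real.log |l| ≠ 0 := fun h' => h ⟨h', hb⟩
    have := bev_single E p q i0 hc0 (by
      intro i h0
      have h1 := congrArg (fun x => Real.log |x|) (hpow i h0)
      simp only [abs_pow, Real.log_pow] at h1
      exact_mod_cast mul_right_cancel₀ hll h1) hE
    rcases this with h | h
    · exact hp0 h
    · rcases hq0 with h' | h'
      · exact h' h
      · exact h' hb
  · have hconst : ∀ i, E.coeff i = C ((E.coeff i).eval 0) := by
      intro i
      by_cases h0 : E.coeff i = 0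
      · simp [h0]
      apply const_of_periodic _ b hb
      have h1 := hi i
      rw [hpow i h0] at h1
      exact mul_left_cancel₀ (by simp [hl]) h1
    have hEm : E = (E.map (evalRingHom 0)).map C := by
      ext1 i
      rw [coeff_map, coeff_map]
      exact hconst i
    have hE0 : E.map (evalRingHom 0) ≠ 0 := by
      intro h
      rw [h] at hEm
      rw [hEm] at hc0
      simp at hc0
    apply hp0
    apply const_of_comp_eq_zero _ _ hE0
    rw [hEm, bev, eval₂_map] at hE
    rw [comp, ← hE]
    congr 1
    ext <;> simp

lemma log_rel_extend (p q : ℝ[X]) (u v : ℤ) (w : ℝ)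
    (hinf : {t : ℝ | p.eval t ≠ 0 ∧ q.eval t ≠ 0 ∧
      u * Real.log |p.eval t| + v * Real.log |q.eval t| = w}.Infinite) (t : ℝ)
    (hpt : p.eval t ≠ 0) (hqt : q.eval t ≠ 0) :
      u * Real.log |p.eval t| + v * Real.log |q.eval t| = w := by
  obtain ⟨u1, u2, rfl⟩ : ∃ u1 u2 : ℕ, u = u1 - u2 := ⟨u.toNat, (-u).toNat, by omega⟩
  obtain ⟨v1, v2, rfl⟩ : ∃ v1 v2 : ℕ, v = v1 - v2 := ⟨v.toNat, (-v).toNat, by omega⟩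
  have key : ∀ x y : ℝ, x ≠ 0 → y ≠ 0 →
      (((u1 - u2 : ℤ) : ℝ) * Real.log |x| + ((v1 - v2 : ℤ) : ℝ) * Real.log |y| = w ↔
      (x ^ 2) ^ u1 * (y ^ 2) ^ v1 = Real.exp (2 * w) * ((x ^ 2) ^ u2 * (y ^ 2) ^ v2)) := by
    intro x y hx hy
    have hx2 : x ^ 2 = Real.exp (2 * Real.log |x|) := by
      rw [mul_comm, Real.exp_mul, Real.exp_log (abs_pos.2 hx)]; norm_cast; simp
    have hy2 : y ^ 2 = Real.exp (2 * Real.log |y|) := by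
      rw [mul_comm, Real.exp_mul, Real.exp_log (abs_pos.2 hy)]; norm_cast; simp
    rw [hx2, hy2]
    simp only [← Real.exp_nat_mul, ← Real.exp_add, Real.exp_eq_exp]
    push_cast
    constructor <;> intro h <;> linarith
  have hpoly : (p ^ 2) ^ u1 * (q ^ 2) ^ v1 =
      C (Real.exp (2 * w)) * ((p ^ 2) ^ u2 * (q ^ 2) ^ v2) := by
    apply eq_of_infinite_eval_eq
    refine hinf.mono ?_
    rintro s ⟨h1, h2, h3⟩
    have := (key _ _ h1 h2).1 h3
    simpa using this
  rw [key _ _ hpt hqt]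
  have := congrArg (eval t) hpoly
  simpa using this

lemma core2 (p q : ℝ[X]) (δ : ℕ) (hδ : 1 ≤ δ) (hp : p.natDegree ≤ δ)
    (hq : q.natDegree ≤ δ) (l m : ℝ) (hl : l ≠ 0) (hm : m ≠ 0)
    (h : ¬ (Real.log |l| = 0 ∧ Real.log |m| = 0))
    (hp0 : p.natDegree ≠ 0) (hq0 : q.natDegree ≠ 0)
    (hline : ¬ ∃ (u v : ℤ) (w : ℝ), u ≠ 0 ∧ ∀ t, p.eval t ≠ 0 → q.eval t ≠ 0 →
      u * Real.log |p.eval t| + v * Real.log |q.eval t| = w) :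
    (∃ T : Finset ℝ, T.card ≤ 4 * δ ^ 2 ∧ ∀ s t, p.eval t = l * p.eval s →
      q.eval t = m * q.eval s → s ∈ T) := by
  rcases core p q δ hδ hp hq l m 0 with hT | ⟨E, hE, i0, j0, hc, hi⟩
  · simpa using hT
  exfalso
  have hc0 : E.coeff i0 ≠ 0 := by
    intro h; simp [h] at hc
  set a1 := Real.log |l| with ha1
  set a2 := Real.log |m| with ha2
  have hmon : ∀ i j, (E.coeff i).coeff j ≠ 0 → i * a1 + j * a2 = i0 * a1 + j0 * a2 := by
    intro i j hij
    have h1 := congrArg (fun e => coeff e j) (hi i)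
    simp only [C_0, add_zero, coeff_C_mul, comp_C_mul_X_coeff] at h1
    have h2 : l ^ i * m ^ j = l ^ i0 * m ^ j0 := by
      apply mul_right_cancel₀ hij
      linarith
    have h3 := congrArg (fun x => Real.log |x|) h2
    simp only [abs_mul, abs_pow] at h3
    rw [Real.log_mul (by positivity) (by positivity), Real.log_mul (by positivity) (by positivity)] at h3
    simpa only [Real.log_pow] using h3
  have hsingle : ¬ ∀ i, E.coeff i ≠ 0 → i = i0 := by
    intro h
    rcases bev_single E p q i0 hc0 h hE with h | h
    · exact hp0 h
    · exact hq0 h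
  have ex : ∀ i, E.coeff i ≠ 0 → ∃ j, (E.coeff i).coeff j ≠ 0 := by
    intro i h0
    exact ⟨_, leadingCoeff_ne_zero.2 h0⟩
  have ha20 : a2 ≠ 0 := by
    intro h2
    have h1 : a1 ≠ 0 := fun h1 => h ⟨h1, h2⟩
    apply hsingle
    intro i h0
    obtain ⟨j, hj⟩ := ex i h0
    have := hmon i j hj
    rw [h2, mul_zero, mul_zero, add_zero, add_zero] at this
    exact_mod_cast mul_right_cancel₀ h1 this
  push Not at hsingle
  obtain ⟨i1, hi1, hne⟩ := hsingle
  obtain ⟨j1, hj1⟩ := ex i1 hi1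
  have hu : ((i1 : ℝ) - i0) ≠ 0 := by
    rw [sub_ne_zero]; exact_mod_cast hne
  have hr1 := hmon i1 j1 hj1
  set r : ℝ := ((j1 : ℝ) - j0) / ((i1 : ℝ) - i0) with hr
  have hslope : ∀ i j, (E.coeff i).coeff j ≠ 0 → (j : ℝ) - j0 = ((i : ℝ) - i0) * r := by
    intro i j hij
    have h1 := hmon i j hij
    rw [hr]
    field_simp
    apply mul_right_cancel₀ ha20
    have e1 : ((j : ℝ) - j0) * a2 = - (((i : ℝ) - i0) * a1) := by linarith
    have e2 : ((j1 : ℝ) - j0) * a2 = - (((i1 : ℝ) - i0) * a1) := by linarith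
    linear_combination (i1 - i0 : ℝ) * e1 - (i - i0 : ℝ) * e2
  let K : ℝ → ℝ[X] := fun τ => E.map (evalRingHom τ)
  have hK : ∀ τ, τ ≠ 0 → K τ ≠ 0 := by
    intro τ hτ h0
    have h1 := congrArg (fun e => coeff e i0) h0
    simp only [K, coeff_map, coeff_zero, coe_evalRingHom] at h1
    have h2 : E.coeff i0 = monomial j0 ((E.coeff i0).coeff j0) := by
      ext1 j
      rw [coeff_monomial]
      split_ifs with hj
      · rw [hj]
      · by_contra h3
        have := hslope i0 j h3
        simp only [sub_self, zero_mul, sub_eq_zero] at this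
        exact hj (by exact_mod_cast this.symm)
    rw [h2, eval_monomial] at h1
    simp [hc, hτ] at h1
  have hroot : ∀ t, p.eval t ≠ 0 → q.eval t ≠ 0 →
      (K (SignType.sign (q.eval t))).eval ((SignType.sign (p.eval t) : ℝ) *
        Real.exp (Real.log |p.eval t| + r * Real.log |q.eval t|)) = 0 := by
    intro t hpt hqt
    have h1 : (bev E p q).eval t = 0 := by rw [hE]; simp
    rw [bev_eval] at h1
    set P := Real.log |p.eval t| with hP
    set Q := Real.log |q.eval t| with hQ
    have hPe : p.eval t = SignType.sign (p.eval t) * Real.exp P := by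
      rw [hP, Real.exp_log (abs_pos.2 hpt), sign_mul_abs]
    have hQe : q.eval t = SignType.sign (q.eval t) * Real.exp Q := by
      rw [hQ, Real.exp_log (abs_pos.2 hqt), sign_mul_abs]
    set σ : ℝ := ((SignType.sign (p.eval t) : SignType) : ℝ)
    set τ : ℝ := ((SignType.sign (q.eval t) : SignType) : ℝ)
    rw [hPe, hQe] at h1
    have h2 : (E.map (evalRingHom (τ * Real.exp Q))).eval (σ * Real.exp P) =
        Real.exp ((j0 - i0 * r) * Q) * (K τ).eval (σ * Real.exp (P + r * Q)) := by
      simp only [K, eval_map, eval₂_eq_sum_range, Finset.mul_sum, coe_evalRingHom]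
      apply Finset.sum_congr rfl
      intro i _
      rw [eval_eq_sum_range, eval_eq_sum_range, Finset.sum_mul, Finset.sum_mul, Finset.mul_sum]
      apply Finset.sum_congr rfl
      intro j _
      by_cases hij : (E.coeff i).coeff j = 0
      · simp [hij]
      have hs := hslope i j hij
      simp only [mul_pow, ← Real.exp_nat_mul]
      have : Real.exp (j * Q) * Real.exp (i * P) =
          Real.exp ((j0 - i0 * r) * Q) * Real.exp (i * (P + r * Q)) := by
        rw [← Real.exp_add, ← Real.exp_add]
        congr 1
        linear_combination Q * hs
      linear_combination (E.coeff i).coeff j * τ ^ j * σ ^ i * this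
    rw [h2] at h1
    exact (mul_eq_zero.1 h1).resolve_left (Real.exp_pos _).ne'
  have hpne : p ≠ 0 := by rintro rfl; simp at hp0
  have hqne : q ≠ 0 := by rintro rfl; simp at hq0
  let A : Set ℝ := {t | p.eval t ≠ 0 ∧ q.eval t ≠ 0}
  have hA : A.Infinite := by
    have : Aᶜ ⊆ ((p * q).roots.toFinset : Set ℝ) := by
      intro t ht
      simp only [A, Set.mem_compl_iff, Set.mem_ofPred_eq, not_and_or, not_not] at ht
      simpa [hpne, hqne] using ht
    have hf : Aᶜ.Finite := (Finset.finite_toSet _).subset this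
    intro hAf
    have := hAf.union hf
    rw [Set.union_compl_self] at this
    exact Set.infinite_univ this
  let W : ℝ → ℝ := fun t => Real.log |p.eval t| + r * Real.log |q.eval t|
  have hsg : ∀ x : ℝ, x ≠ 0 → ((SignType.sign x : ℝ) = 1 ∨ (SignType.sign x : ℝ) = -1) := by
    intro x hx
    rcases lt_or_gt_of_ne hx with h | h
    · right; simp [sign_neg h]
    · left; simp [sign_pos h]
  let Z : Finset ℝ := (K 1).roots.toFinset ∪ (K (-1)).roots.toFinset
  have hWfin : (W '' A).Finite := by
    apply ((Z.image (fun x => Real.log |x|)).finite_toSet).subset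
    rintro _ ⟨t, ⟨h1, h2⟩, rfl⟩
    have h3 := hroot t h1 h2
    have hz : ((SignType.sign (p.eval t) : ℝ) *
        Real.exp (Real.log |p.eval t| + r * Real.log |q.eval t|)) ∈ Z := by
      simp only [Z, Finset.mem_union, Multiset.mem_toFinset, mem_roots', IsRoot.def]
      rcases hsg _ h2 with h4 | h4
      · left; rw [h4] at h3; exact ⟨hK 1 one_ne_zero, h3⟩
      · right; rw [h4] at h3; exact ⟨hK (-1) (by norm_num), h3⟩
    simp only [Finset.coe_image, Set.mem_image]
    refine ⟨_, hz, ?_⟩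
    have habs : |(SignType.sign (p.eval t) : ℝ)| = 1 := by
      rcases hsg _ h1 with h4 | h4 <;> simp [h4]
    rw [abs_mul, habs, one_mul, Real.abs_exp, Real.log_exp]
  obtain ⟨w, hw⟩ : ∃ w, {t | t ∈ A ∧ W t = w}.Infinite := by
    by_contra! hcon
    apply hA
    have : A ⊆ ⋃ w ∈ W '' A, {t | t ∈ A ∧ W t = w} := by
      intro t ht
      simp only [Set.mem_iUnion]
      exact ⟨W t, ⟨t, ht, rfl⟩, ht, rfl⟩
    exact (hWfin.biUnion (fun w _ => hcon w)).subset this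
  apply hline
  refine ⟨(i1 : ℤ) - i0, (j1 : ℤ) - j0, ((i1 : ℝ) - i0) * w, ?_, ?_⟩
  · rw [sub_ne_zero]; exact_mod_cast hne
  · intro t h1 h2
    apply log_rel_extend p q _ _ _ _ t h1 h2
    refine hw.mono ?_
    rintro s ⟨⟨h3, h4⟩, h5⟩
    refine ⟨h3, h4, ?_⟩
    rw [← h5]
    simp only [W, hr]
    push_cast
    field_simp

lemma log_eq_cases {x y a : ℝ} (hx : x ≠ 0) (hy : y ≠ 0)
    (h : Real.log |y| + a = Real.log |x|) : ∃ ε ∈ ({1, -1} : Finset ℝ), x = ε * Real.exp a * y := by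
  have h1 : |x| = |Real.exp a * y| := by
    rw [← Real.exp_log (abs_pos.2 hx), ← h, Real.exp_add, Real.exp_log (abs_pos.2 hy), abs_mul,
      Real.abs_exp, mul_comm]
  rcases abs_eq_abs.1 h1 with h | h
  · exact ⟨1, by simp, by rw [h]; ring⟩
  · exact ⟨-1, by simp, by rw [h]; ring⟩

lemma log_eps {ε a : ℝ} (h : ε ∈ ({1, -1} : Finset ℝ)) : Real.log |ε * Real.exp a| = a := by
  simp only [Finset.mem_insert, Finset.mem_singleton] at h
  rcases h with rfl | rfl <;> simp

lemma eps_ne {ε a : ℝ} (h : ε ∈ ({1, -1} : Finset ℝ)) : ε * Real.exp a ≠ 0 := by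
  simp only [Finset.mem_insert, Finset.mem_singleton] at h
  rcases h with rfl | rfl <;> simp

lemma union_eps (n : ℕ) (R : ℝ → ℝ → ℝ → Prop)
    (h : ∀ ε ∈ ({1, -1} : Finset ℝ), ∃ T : Finset ℝ, T.card ≤ n ∧ ∀ s t, R ε s t → s ∈ T) :
    ∃ T : Finset ℝ, T.card ≤ 2 * n ∧ ∀ s t, (∃ ε ∈ ({1, -1} : Finset ℝ), R ε s t) → s ∈ T := by
  obtain ⟨T1, h1, h1'⟩ := h 1 (by simp)
  obtain ⟨T2, h2, h2'⟩ := h (-1) (by simp)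
  refine ⟨T1 ∪ T2, (Finset.card_union_le _ _).trans (by omega), ?_⟩
  rintro s t ⟨ε, hε, hR⟩
  simp only [Finset.mem_insert, Finset.mem_singleton] at hε
  rcases hε with rfl | rfl
  · exact Finset.mem_union_left _ (h1' s t hR)
  · exact Finset.mem_union_right _ (h2' s t hR)

theorem stmt7 (δ : ℕ) (hδ : 1 ≤ δ) (p q : Polynomial ℝ)
    (hp : p.natDegree ≤ δ) (hq : q.natDegree ≤ δ)
    (f g : ℝ → ℝ) (Df Dg : ℝ → Prop)
    (hf : ((f = fun x : ℝ => Real.log |x|) ∧ Df = fun x : ℝ => x ≠ 0) ∨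
      (f = id ∧ Df = fun _ : ℝ => True))
    (hg : ((g = fun x : ℝ => Real.log |x|) ∧ Dg = fun x : ℝ => x ≠ 0) ∨
      (g = id ∧ Dg = fun _ : ℝ => True))
    (C : Set (ℝ × ℝ))
    (hC : C = {z : ℝ × ℝ | ∃ t : ℝ, Df (p.eval t) ∧ Dg (q.eval t) ∧
      z = (f (p.eval t), g (q.eval t))})
    (hline : ¬ ∃ α β γ : ℝ, ¬(α = 0 ∧ β = 0) ∧
        ∀ z ∈ C, α * z.1 + β * z.2 = γ)
    (a : ℝ × ℝ) (ha : a ≠ 0) :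
    (((fun z : ℝ × ℝ => z + a) '' C) ∩ C).Finite ∧
      (((fun z : ℝ × ℝ => z + a) '' C) ∩ C).ncard ≤ 16 * δ ^ 2 := by
  suffices hT : ∃ T : Finset ℝ, T.card ≤ 16 * δ ^ 2 ∧ ∀ s t, Df (p.eval s) → Dg (q.eval s) →
      Df (p.eval t) → Dg (q.eval t) → f (p.eval s) + a.1 = f (p.eval t) →
      g (q.eval s) + a.2 = g (q.eval t) → s ∈ T by
    obtain ⟨T, hT, h⟩ := hT
    have hsub : (((fun z : ℝ × ℝ => z + a) '' C) ∩ C) ⊆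
        ((T.image (fun s => (f (p.eval s), g (q.eval s)) + a) : Finset (ℝ × ℝ)) : Set (ℝ × ℝ)) := by
      rintro z ⟨⟨y, hy, hyz⟩, hz⟩
      rw [hC] at hy hz
      obtain ⟨s, h1, h2, rfl⟩ := hy
      obtain ⟨t, h3, h4, rfl⟩ := hz
      simp only [Prod.ext_iff, Prod.fst_add, Prod.snd_add] at hyz
      rw [Finset.coe_image]
      refine ⟨s, h s t h1 h2 h3 h4 hyz.1 hyz.2, ?_⟩
      exact Prod.ext hyz.1 hyz.2
    refine ⟨(Finset.finite_toSet _).subset hsub, ?_⟩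
    calc _ ≤ _ := Set.ncard_le_ncard hsub (Finset.finite_toSet _)
      _ ≤ _ := by
        rw [Set.ncard_coe_finset]
        exact Finset.card_image_le.trans hT
  have hp0 : p.natDegree ≠ 0 := by
    intro h
    obtain ⟨c, hc⟩ := natDegree_eq_zero.1 h
    apply hline
    refine ⟨1, 0, f c, by simp, ?_⟩
    intro z hz
    rw [hC] at hz
    obtain ⟨t, _, _, rfl⟩ := hz
    simp [← hc]
  have hq0 : q.natDegree ≠ 0 := by
    intro h
    obtain ⟨c, hc⟩ := natDegree_eq_zero.1 h
    apply hline
    refine ⟨0, 1, g c, by simp, ?_⟩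
    intro z hz
    rw [hC] at hz
    obtain ⟨t, _, _, rfl⟩ := hz
    simp [← hc]
  have ha' : ¬ (a.1 = 0 ∧ a.2 = 0) := fun h => ha (Prod.ext h.1 h.2)
  rcases hf with ⟨rfl, rfl⟩ | ⟨rfl, rfl⟩ <;> rcases hg with ⟨rfl, rfl⟩ | ⟨rfl, rfl⟩
  · -- log, log
    have h2 := union_eps (2 * (4 * δ ^ 2)) (fun ε s t => ∃ ε' ∈ ({1, -1} : Finset ℝ),
      p.eval t = ε * Real.exp a.1 * p.eval s ∧ q.eval t = ε' * Real.exp a.2 * q.eval s) (by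
        intro ε hε
        apply union_eps (4 * δ ^ 2) (fun ε' s t =>
          p.eval t = ε * Real.exp a.1 * p.eval s ∧ q.eval t = ε' * Real.exp a.2 * q.eval s)
        intro ε' hε'
        obtain ⟨T, hT, h⟩ := core2 p q δ hδ hp hq (ε * Real.exp a.1) (ε' * Real.exp a.2)
          (eps_ne hε) (eps_ne hε') (by rwa [log_eps hε, log_eps hε']) hp0 hq0 (by
            rintro ⟨u, v, w, hu, h⟩
            apply hline
            refine ⟨u, v, w, fun h => hu (by exact_mod_cast h.1), ?_⟩
            intro z hz
            rw [hC] at hz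
            obtain ⟨t, h1, h2, rfl⟩ := hz
            exact h t h1 h2)
        exact ⟨T, hT, fun s t hst => h s t hst.1 hst.2⟩)
    obtain ⟨T, hT, h⟩ := h2
    refine ⟨T, hT.trans (by omega), ?_⟩
    intro s t h1 h2 h3 h4 h5 h6
    obtain ⟨ε, hε, e1⟩ := log_eq_cases h3 h1 h5
    obtain ⟨ε', hε', e2⟩ := log_eq_cases h4 h2 h6
    exact h s t ⟨ε, hε, ε', hε', e1, e2⟩
  · -- log, id
    obtain ⟨T, hT, h⟩ := union_eps (4 * δ ^ 2) (fun ε s t =>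
      p.eval t = ε * Real.exp a.1 * p.eval s ∧ q.eval t = q.eval s + a.2) (by
        intro ε hε
        obtain ⟨T, hT, h⟩ := core1 p q δ hδ hp hq (ε * Real.exp a.1) a.2
          (eps_ne hε) (by rwa [log_eps hε]) hp0 (Or.inl hq0)
        exact ⟨T, hT, fun s t hst => h s t hst.1 hst.2⟩)
    refine ⟨T, hT.trans (by omega), ?_⟩
    intro s t h1 h2 h3 h4 h5 h6
    obtain ⟨ε, hε, e1⟩ := log_eq_cases h3 h1 h5
    exact h s t ⟨ε, hε, e1, h6.symm⟩
  · -- id, log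
    obtain ⟨T, hT, h⟩ := union_eps (4 * δ ^ 2) (fun ε s t =>
      q.eval t = ε * Real.exp a.2 * q.eval s ∧ p.eval t = p.eval s + a.1) (by
        intro ε hε
        obtain ⟨T, hT, h⟩ := core1 q p δ hδ hq hp (ε * Real.exp a.2) a.1
          (eps_ne hε) (by rw [log_eps hε]; exact fun h => ha' h.symm) hq0 (Or.inl hp0)
        exact ⟨T, hT, fun s t hst => h s t hst.1 hst.2⟩)
    refine ⟨T, hT.trans (by omega), ?_⟩
    intro s t h1 h2 h3 h4 h5 h6
    obtain ⟨ε, hε, e1⟩ := log_eq_cases h4 h2 h6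
    exact h s t ⟨ε, hε, e1, h5.symm⟩
  · -- id, id
    by_cases h1 : a.1 = 0
    · have h2 : a.2 ≠ 0 := fun h2 => ha' ⟨h1, h2⟩
      obtain ⟨T, hT, h⟩ := core1 p q δ hδ hp hq 1 a.2 one_ne_zero (by simp [h2]) hp0 (Or.inl hq0)
      refine ⟨T, hT.trans (by omega), ?_⟩
      intro s t _ _ _ _ h5 h6
      apply h s t
      · simp only [id, h1] at h5
        linarith
      · exact h6.symm
    · obtain ⟨T, hT, h⟩ := core1 (q - Polynomial.C (a.2 / a.1) * p) p δ hδ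
        ((natDegree_sub_le_of_le hq ((natDegree_C_mul_le _ _).trans hp)).trans (max_self _).le) hp
        1 a.1 one_ne_zero (by simp [h1]) (by
          intro h
          obtain ⟨c, hc⟩ := natDegree_eq_zero.1 h
          apply hline
          refine ⟨-(a.2 / a.1), 1, c, by simp, ?_⟩
          intro z hz
          rw [hC] at hz
          obtain ⟨t, _, _, rfl⟩ := hz
          have := congrArg (eval t) hc
          simp only [eval_C, eval_sub, eval_mul] at this
          simp only [id]
          linarith) (Or.inl hp0)
      refine ⟨T, hT.trans (by omega), ?_⟩
      intro s t _ _ _ _ h5 h6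
      simp only [id] at h5 h6
      apply h s t
      · simp only [eval_C, eval_sub, eval_mul]
        rw [← h5, ← h6]
        field_simp
        ring
      · exact h5.symm
end

section
/- Let p_1, p_2, q_1, q_2 ∈ ℝ[x] be nonconstant monic polynomials, each of degree at most δ. Assume p_1 ≢_m q_1. Then there exists a constant c > 0 depending only on δ such that for all n ∈ ℕ and all finite sets A, B ⊂ ℝ with |A| = |B| = n, |p_1(A) · p_2(B)| · |q_1(A) · q_2(B)| ≥ c · n^{5/2}. -/
open Polynomial Pointwise

noncomputable section

/-- `p ≡_m q` : there is a positive rational `κ` with `|p(x)| = |q(x)|^κ` for all real `x`. -/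
def EquivM (p q : Polynomial ℝ) : Prop :=
  ∃ k : ℚ, 0 < k ∧ ∀ x : ℝ, |p.eval x| = |q.eval x| ^ (k : ℝ)

open Filter Topology in
theorem algC (P Q : ℂ[X]) (hP : P.Monic) (hQ : Q.Monic) (hd : 0 < P.natDegree)
    (l : ℝ) (hl : 1 < l) (m : ℂ) (hm : m ≠ 0)
    (H : ∀ x, ∃ y, P.eval y = l * P.eval x ∧ Q.eval y = m * Q.eval x) :
    P ^ Q.natDegree = Q ^ P.natDegree := by
  choose s hs1 hs2 using H
  have key : ∀ x, P.eval x ≠ 0 → Q.eval x ≠ 0 →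
      (P ^ Q.natDegree).eval x = (Q ^ P.natDegree).eval x := by
    intro x hx hx'
    set z : ℕ → ℂ := fun k => s^[k] x with hz
    have z1 : ∀ k, P.eval (z k) = (l : ℂ) ^ k * P.eval x := by
      intro k
      induction k with
      | zero => simp [hz]
      | succ k ih =>
        have : z (k+1) = s (z k) := by simp [hz, Function.iterate_succ_apply']
        rw [this, hs1, ih]; ring
    have z2 : ∀ k, Q.eval (z k) = m ^ k * Q.eval x := by
      intro k
      induction k with
      | zero => simp [hz]
      | succ k ih =>
        have : z (k+1) = s (z k) := by simp [hz, Function.iterate_succ_apply']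
        rw [this, hs2, ih]; ring
    have hl0 : (l : ℂ) ≠ 0 := by exact_mod_cast (by positivity : l ≠ 0)
    have t1 : Tendsto (fun k => P.eval (z k)) atTop (Bornology.cobounded ℂ) := by
      rw [← tendsto_norm_atTop_iff_cobounded]
      have : (fun k => ‖P.eval (z k)‖) = fun k => l ^ k * ‖P.eval x‖ := by
        funext k; rw [z1]; simp [abs_of_pos (by positivity : 0 < l)]
      rw [this]
      exact (tendsto_pow_atTop_atTop_of_one_lt hl).atTop_mul_const (norm_pos_iff.2 hx)
    have t2 : Tendsto z atTop (Bornology.cobounded ℂ) := by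
      rw [Metric.cobounded_eq_cocompact] at t1 ⊢
      exact (tendsto_comap_iff.2 t1).mono_right (Filter.comap_cocompact_le P.continuous)
    have hdeg : (P ^ Q.natDegree).degree = (Q ^ P.natDegree).degree := by
      rw [degree_eq_natDegree (hP.pow _).ne_zero, degree_eq_natDegree (hQ.pow _).ne_zero,
        hP.natDegree_pow, hQ.natDegree_pow, mul_comm]
    have o := isLittleO_cobounded_of_degree_lt (P := P ^ Q.natDegree - Q ^ P.natDegree)
      (Q := Q ^ P.natDegree) (by
        rw [← hdeg]
        exact degree_sub_lt_left hdeg (hP.pow _).ne_zero (by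
          rw [(hP.pow _).leadingCoeff, (hQ.pow _).leadingCoeff]))
    have t3 := (o.comp_tendsto t2).tendsto_div_nhds_zero
    set c : ℂ := (l:ℂ) ^ Q.natDegree / m ^ P.natDegree with hc
    set h : ℂ := (P ^ Q.natDegree).eval x / (Q ^ P.natDegree).eval x with hh
    have hc0 : c ≠ 0 := by simp [hc, hm, hl0]
    have hh0 : h ≠ 0 := by simp [hh, hx, hx']
    have t4 : Tendsto (fun k : ℕ => c ^ k * h) atTop (𝓝 1) := by
      have := t3.add_const 1
      rw [zero_add] at this
      refine this.congr fun k => ?_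
      have : Q.eval (z k) ≠ 0 := by rw [z2]; simp [hm, hx']
      have e1 : m ^ k ≠ 0 := pow_ne_zero _ hm
      simp only [Function.comp, eval_sub, eval_pow, z1, z2, hc, hh]
      rw [z2] at this
      rw [sub_div, div_self (pow_ne_zero _ this), sub_add_cancel, mul_pow, mul_pow, ← pow_mul,
        ← pow_mul, div_pow, ← pow_mul, ← pow_mul, mul_div_mul_comm, mul_comm k, mul_comm k]
    have t5 : Tendsto (fun k : ℕ => c ^ (k+1) * h) atTop (𝓝 1) := t4.comp (tendsto_add_atTop_nat 1)
    have c1 : c = 1 := by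
      have := t5.div t4 one_ne_zero
      rw [div_one] at this
      refine tendsto_nhds_unique (f := fun _ : ℕ => c) (l := atTop) tendsto_const_nhds
        (this.congr fun k => ?_)
      have := pow_ne_zero k hc0
      simp only [Pi.div_apply]
      field_simp
      ring
    have h1 : h = 1 := by
      refine tendsto_nhds_unique (f := fun _ : ℕ => h) (l := atTop) tendsto_const_nhds
        (t4.congr fun k => ?_)
      rw [c1]; simp
    rw [hh, div_eq_one_iff_eq] at h1
    · exact h1
    · simp [hx']
  have : (P ^ Q.natDegree - Q ^ P.natDegree) * (P * Q) = 0 := by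
    apply Polynomial.funext
    intro x
    simp only [eval_mul, eval_sub, eval_zero]
    by_cases hx : P.eval x = 0
    · simp [hx]
    by_cases hx' : Q.eval x = 0
    · simp [hx']
    rw [key x hx hx']; simp
  rcases mul_eq_zero.1 this with h | h
  · exact sub_eq_zero.1 h
  · exact absurd h (mul_ne_zero hP.ne_zero hQ.ne_zero)

theorem equivM_of_pow (p q : ℝ[X]) (hd : 0 < p.natDegree) (he : 0 < q.natDegree)
    (h : p ^ q.natDegree = q ^ p.natDegree) : EquivM p q := by
  refine ⟨(p.natDegree : ℚ) / q.natDegree, by positivity, fun x => ?_⟩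
  have h1 : |p.eval x| ^ q.natDegree = |q.eval x| ^ p.natDegree := by
    rw [← abs_pow, ← abs_pow, ← eval_pow, ← eval_pow, h]
  push_cast
  rw [div_eq_mul_inv, Real.rpow_mul (abs_nonneg _), Real.rpow_natCast, ← h1,
    Real.pow_rpow_inv_natCast (abs_nonneg _) he.ne']

/-- shifted polynomial in the second variable -/
noncomputable def shf (p : ℝ[X]) (l : ℝ) : ℝ[X][X] := p.map C - C (C l * p)

theorem natDegree_shf_coeff (p : ℝ[X]) (l : ℝ) (i : ℕ) :
    ((shf p l).coeff i).natDegree ≤ p.natDegree := by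
  unfold shf
  rw [coeff_sub, coeff_map, coeff_C]
  refine (natDegree_sub_le _ _).trans ?_
  rw [natDegree_C]
  split_ifs
  · simpa using natDegree_C_mul_le l p
  · simp

theorem natDegree_res (p q : ℝ[X]) (l m : ℝ) (δ : ℕ) (hp : p.natDegree ≤ δ) (hq : q.natDegree ≤ δ) :
    (resultant (shf p l) (shf q m) p.natDegree q.natDegree).natDegree ≤ 2 * δ * δ := by
  unfold resultant
  rw [Matrix.det_apply]
  refine natDegree_sum_le_of_forall_le _ _ fun σ _ => ?_
  have : ∀ (u : ℤˣ) (r : ℝ[X]), (u • r).natDegree = r.natDegree := by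
    intro u r
    rcases Int.units_eq_one_or u with h | h <;> simp [h]
  rw [this]
  refine (natDegree_prod_le _ _).trans ?_
  refine (Finset.sum_le_card_nsmul _ _ δ fun i _ => ?_).trans ?_
  · unfold sylvester
    rw [Matrix.of_apply]
    refine Fin.addCases (fun j => ?_) (fun j => ?_) i
    · rw [Fin.addCases_left]
      split_ifs
      · exact (natDegree_shf_coeff _ _ _).trans hq
      · simp
    · rw [Fin.addCases_right]
      split_ifs
      · exact (natDegree_shf_coeff _ _ _).trans hp
      · simp
  · simp only [Finset.card_univ, Fintype.card_fin, smul_eq_mul]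
    gcongr
    omega

theorem res_eval (p q : ℝ[X]) (hp : p.Monic)  (hd : 0 < p.natDegree)
    (l m : ℝ) (x : ℂ) :
    aeval x (resultant (shf p l) (shf q m) p.natDegree q.natDegree) = 0 ↔
    ∃ y : ℂ, aeval y p = l * aeval x p ∧ aeval y q = m * aeval x q := by
  have hm : ∀ (p : ℝ[X]) (l : ℝ), (shf p l).map (aeval x : ℝ[X] →ₐ[ℝ] ℂ).toRingHom =
      p.map (algebraMap ℝ ℂ) - C (l * aeval x p) := by
    intro p l
    unfold shf
    rw [Polynomial.map_sub, Polynomial.map_map, map_C]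
    congr 2
    · ext; simp
    · simp
  have h1 := resultant_map_map (shf p l) (shf q m) p.natDegree q.natDegree
    (aeval x : ℝ[X] →ₐ[ℝ] ℂ).toRingHom
  have h2 : aeval x (resultant (shf p l) (shf q m) p.natDegree q.natDegree) =
    resultant (p.map (algebraMap ℝ ℂ) - C (l * aeval x p))
      (q.map (algebraMap ℝ ℂ) - C (m * aeval x q)) p.natDegree q.natDegree := by
    rw [← hm, ← hm, h1]; rfl
  have hdd : (p.map (algebraMap ℝ ℂ) - C (l * aeval x p)).natDegree = p.natDegree := by
    rw [natDegree_sub_C, natDegree_map]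
  have hmon : (p.map (algebraMap ℝ ℂ) - C (l * aeval x p)).Monic := by
    rw [Monic, leadingCoeff, hdd, coeff_sub, coeff_map, coeff_C, if_neg hd.ne']
    simp [hp]
  have h3 := resultant_eq_prod_eval (p.map (algebraMap ℝ ℂ) - C (l * aeval x p))
      (q.map (algebraMap ℝ ℂ) - C (m * aeval x q)) q.natDegree
      (by rw [natDegree_sub_C, natDegree_map]) (IsAlgClosed.splits _)
  rw [hdd] at h3
  rw [h2, h3, hmon.leadingCoeff, one_pow, one_mul, Multiset.prod_eq_zero_iff]
  simp only [Multiset.mem_map, mem_roots hmon.ne_zero, IsRoot, eval_sub, eval_map_algebraMap, eval_C,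
    sub_eq_zero]

theorem alg (δ : ℕ) (p q : ℝ[X]) (hp : p.Monic) (hq : q.Monic) (hd : 0 < p.natDegree)
    (he : 0 < q.natDegree) (hp' : p.natDegree ≤ δ) (hq' : q.natDegree ≤ δ) (hn : ¬ EquivM p q)
    (l m : ℝ) (hl : 1 < l) (hm : m ≠ 0) :
    ∃ R : ℝ[X], R ≠ 0 ∧ R.natDegree ≤ 2 * δ * δ ∧
      ∀ x y : ℝ, p.eval y = l * p.eval x → q.eval y = m * q.eval x → R.eval x = 0 := by
  refine ⟨resultant (shf p l) (shf q m) p.natDegree q.natDegree, ?_,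
    natDegree_res p q l m δ hp' hq', ?_⟩
  · intro h0
    apply hn
    apply equivM_of_pow p q hd he
    have h1 := algC (p.map (algebraMap ℝ ℂ)) (q.map (algebraMap ℝ ℂ)) (hp.map _) (hq.map _)
      (by rwa [natDegree_map]) l hl m (by exact_mod_cast hm) (by
        intro x
        have := (res_eval p q hp hd l m x).1 (by rw [h0]; simp)
        simpa only [eval_map_algebraMap] using this)
    rw [natDegree_map, natDegree_map, ← Polynomial.map_pow, ← Polynomial.map_pow] at h1
    exact Polynomial.map_injective _ (algebraMap ℝ ℂ).injective h1
  · intro x y h1 h2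
    have := (res_eval p q hp hd l m x).2 ⟨y, by
      have := fun (r : ℝ[X]) (t : ℝ) => aeval_algebraMap_apply ℂ t r
      simp only [Complex.coe_algebraMap, coe_aeval_eq_eval] at this
      rw [this, this, this, this, h1, h2]; simp⟩
    have h4 := aeval_algebraMap_apply ℂ x
      (resultant (shf p l) (shf q m) p.natDegree q.natDegree)
    simp only [Complex.coe_algebraMap, coe_aeval_eq_eval] at h4
    rw [h4] at this
    exact_mod_cast this

/-- rank of `x` in the finite set `S` -/
noncomputable def rk (S : Finset ℝ) (x : ℝ) : ℕ := (S.filter (· < x)).card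

theorem rk_le (S : Finset ℝ) (x : ℝ) : rk S x ≤ S.card := Finset.card_filter_le _ _

theorem rk_lt (S : Finset ℝ) {x y : ℝ} (hx : x ∈ S) (h : x < y) : rk S x < rk S y := by
  apply Finset.card_lt_card
  rw [Finset.ssubset_iff_of_subset]
  · exact ⟨x, by simp [hx, h], by simp⟩
  · intro z hz
    simp only [Finset.mem_filter] at hz ⊢
    exact ⟨hz.1, hz.2.trans h⟩

theorem rk_inj (S : Finset ℝ) {x y : ℝ} (hx : x ∈ S) (hy : y ∈ S) (h : rk S x = rk S y) : x = y := by
  rcases lt_trichotomy x y with h1 | h1 | h1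
  · exact absurd h (rk_lt S hx h1).ne
  · exact h1
  · exact absurd h (rk_lt S hy h1).ne'

theorem bad_count (N : ℕ) (g : ℕ → ℝ) (M L : ℝ)
    (hg : (∀ i < N, g i ≤ g (i+1)) ∨ (∀ i < N, g (i+1) ≤ g i))
    (h0 : ∀ i, 0 ≤ g i) (hM : ∀ i, g i ≤ M) :
    (((Finset.range N).filter fun i => L ≤ |g (i+1) - g i|).card : ℝ) * L ≤ M := by
  calc (((Finset.range N).filter fun i => L ≤ |g (i+1) - g i|).card : ℝ) * L
      = ∑ i ∈ (Finset.range N).filter fun i => L ≤ |g (i+1) - g i|, L := by simp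
    _ ≤ ∑ i ∈ (Finset.range N).filter fun i => L ≤ |g (i+1) - g i|, |g (i+1) - g i| :=
        Finset.sum_le_sum fun i hi => (Finset.mem_filter.1 hi).2
    _ ≤ ∑ i ∈ Finset.range N, |g (i+1) - g i| :=
        Finset.sum_le_sum_of_subset_of_nonneg (Finset.filter_subset _ _) fun _ _ _ => abs_nonneg _
    _ ≤ M := by
        rcases hg with hg | hg
        · rw [Finset.sum_congr rfl fun i hi =>
            abs_of_nonneg (sub_nonneg.2 (hg i (Finset.mem_range.1 hi))), Finset.sum_range_sub]
          linarith [h0 0, hM N]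
        · rw [Finset.sum_congr rfl fun i hi =>
            abs_of_nonpos (sub_nonpos.2 (hg i (Finset.mem_range.1 hi))), Finset.sum_neg_distrib,
            Finset.sum_range_sub]
          linarith [h0 N, hM 0]

/-- pairs of elements of `S` that are close in rank -/
noncomputable def cp (S : Finset ℝ) (L : ℝ) : Finset (ℝ × ℝ) :=
  (S ×ˢ S).filter fun z => |(rk S z.2 : ℝ) - rk S z.1| < L

theorem cp_card (S : Finset ℝ) (L : ℝ) (hL : 0 ≤ L) : ((cp S L).card : ℝ) ≤ (2 * L + 1) * S.card := by
  have h : (cp S L).card ≤ (2 * ⌊L⌋₊ + 1) * S.card := by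
    apply Finset.card_le_mul_card_image_of_maps_to (f := Prod.fst)
    · intro z hz
      exact (Finset.mem_product.1 (Finset.mem_filter.1 hz).1).1
    · intro s hs
      have : (Finset.Icc (-(⌊L⌋₊ : ℤ)) ⌊L⌋₊).card = 2 * ⌊L⌋₊ + 1 := by
        rw [Int.card_Icc]; omega
      rw [← this]
      apply Finset.card_le_card_of_injOn (fun z => (rk S z.2 : ℤ) - rk S s)
      · intro z hz
        simp only [cp, Finset.coe_filter, Finset.mem_filter, Finset.mem_product, Set.mem_ofPred_eq] at hz
        obtain ⟨⟨_, h1⟩, h2⟩ := hz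
        rw [h2] at h1
        simp only [Finset.coe_Icc, Set.mem_Icc]
        rw [← abs_le]
        have h3 : (((|(rk S z.2 : ℤ) - rk S s|).toNat : ℕ) : ℝ) ≤ L := by
          have e : (((|(rk S z.2 : ℤ) - rk S s|).toNat : ℤ)) = |(rk S z.2 : ℤ) - rk S s| :=
            Int.toNat_of_nonneg (abs_nonneg _)
          have e' : (((|(rk S z.2 : ℤ) - rk S s|).toNat : ℤ) : ℝ) =
            ((|(rk S z.2 : ℤ) - rk S s| : ℤ) : ℝ) := by rw [e]
          push_cast at e'
          rw [e']
          exact h1.le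
        have h4 := Nat.le_floor h3
        omega
      · intro z hz w hw hzw
        simp only [cp, Finset.coe_filter, Finset.mem_filter, Finset.mem_product, Set.mem_ofPred_eq] at hz hw
        have : rk S z.2 = rk S w.2 := by simp only at hzw; omega
        exact Prod.ext (hz.2.trans hw.2.symm) (rk_inj S hz.1.1.2 hw.1.1.2 this)
  calc ((cp S L).card : ℝ) ≤ (((2 * ⌊L⌋₊ + 1) * S.card : ℕ) : ℝ) := by exact_mod_cast h
    _ = (2 * (⌊L⌋₊ : ℝ) + 1) * S.card := by push_cast; ring
    _ ≤ _ := by gcongr; exact Nat.floor_le hL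

theorem rk_seq (N : ℕ) (F : ℕ → ℝ) (S : Finset ℝ) (u : ℝ) (hu : u ≠ 0)
    (hF : (∀ i < N, F i < F (i+1)) ∨ (∀ i < N, F (i+1) < F i))
    (hS : ∀ i ≤ N, u * F i ∈ S) :
    (∀ i < N, rk S (u * F i) < rk S (u * F (i+1))) ∨ (∀ i < N, rk S (u * F (i+1)) < rk S (u * F i)) := by
  rcases lt_or_gt_of_ne hu with h | h <;> rcases hF with hF | hF
  · right
    exact fun i hi => rk_lt S (hS _ hi) (mul_lt_mul_of_neg_left (hF i hi) h)
  · left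
    exact fun i hi => rk_lt S (hS _ hi.le) (mul_lt_mul_of_neg_left (hF i hi) h)
  · left
    exact fun i hi => rk_lt S (hS _ hi.le) (mul_lt_mul_of_pos_left (hF i hi) h)
  · right
    exact fun i hi => rk_lt S (hS _ hi) (mul_lt_mul_of_pos_left (hF i hi) h)

theorem seq_bad (N : ℕ) (F : ℕ → ℝ) (S : Finset ℝ) (u : ℝ) (hu : u ≠ 0)
    (hF : (∀ i < N, F i < F (i+1)) ∨ (∀ i < N, F (i+1) < F i))
    (hS : ∀ i ≤ N, u * F i ∈ S) (L : ℝ) :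
    (((Finset.range N).filter fun i =>
      L ≤ |(rk S (u * F (i+1)) : ℝ) - rk S (u * F i)|).card : ℝ) * L ≤ S.card := by
  apply bad_count N (fun i => (rk S (u * F i) : ℝ))
  · rcases rk_seq N F S u hu hF hS with h | h
    · left; intro i hi; exact_mod_cast (h i hi).le
    · right; intro i hi; exact_mod_cast (h i hi).le
  · intro i; positivity
  · intro i; exact_mod_cast rk_le _ _

theorem seq_card (N : ℕ) (F : ℕ → ℝ) (S : Finset ℝ) (u : ℝ) (hu : u ≠ 0)
    (hF : (∀ i < N, F i < F (i+1)) ∨ (∀ i < N, F (i+1) < F i))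
    (hS : ∀ i ≤ N, u * F i ∈ S) : (N : ℝ) ≤ S.card := by
  have h := seq_bad N F S u hu hF hS 1
  rw [Finset.filter_true_of_mem] at h
  · simpa using h
  · intro i hi
    have hi := Finset.mem_range.1 hi
    rcases rk_seq N F S u hu hF hS with h | h
    · rw [le_abs]; left
      have := h i hi
      have : ((rk S (u * F i) + 1 : ℕ) : ℝ) ≤ rk S (u * F (i+1)) := by exact_mod_cast this
      push_cast at this; linarith
    · rw [le_abs]; right
      have := h i hi
      have : ((rk S (u * F (i+1)) + 1 : ℕ) : ℝ) ≤ rk S (u * F i) := by exact_mod_cast this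
      push_cast at this; linarith

theorem comb (N : ℕ) (hN : 0 < N) (F G : ℕ → ℝ)
    (hF : (∀ i < N, F i < F (i+1)) ∨ (∀ i < N, F (i+1) < F i))
    (hG : (∀ i < N, G i < G (i+1)) ∨ (∀ i < N, G (i+1) < G i))
    (hF0 : ∀ i ≤ N, F i ≠ 0) (hG0 : ∀ i ≤ N, G i ≠ 0)
    (U V S T : Finset ℝ) (hU : ∀ u ∈ U, u ≠ 0) (hV : ∀ u ∈ V, u ≠ 0)
    (hS : ∀ u ∈ U, ∀ i ≤ N, u * F i ∈ S) (hT : ∀ u ∈ V, ∀ i ≤ N, u * G i ∈ T) (K : ℕ)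
    (hK : ∀ l m : ℝ, ((Finset.range N).filter fun i =>
      F (i+1) = l * F i ∧ G (i+1) = m * G i).card ≤ K) :
    (U.card : ℝ) * V.card * N ^ 3 ≤ 288 * K * ((S.card : ℝ) * T.card) ^ 2 := by
  rcases U.eq_empty_or_nonempty with hUe | ⟨u₀, hu₀⟩
  · simp only [hUe, Finset.card_empty, Nat.cast_zero, zero_mul]; positivity
  rcases V.eq_empty_or_nonempty with hVe | ⟨v₀, hv₀⟩
  · simp only [hVe, Finset.card_empty, Nat.cast_zero, zero_mul, mul_zero]; positivity
  have hNR : (0:ℝ) < N := by exact_mod_cast hN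
  have cS : (N:ℝ) ≤ S.card := seq_card N F S u₀ (hU _ hu₀) hF (hS _ hu₀)
  have cT : (N:ℝ) ≤ T.card := seq_card N G T v₀ (hV _ hv₀) hG (hT _ hv₀)
  set s : ℝ := (S.card : ℝ) with hs
  set t : ℝ := (T.card : ℝ) with ht
  set L : ℝ := 4 * s / N with hL
  set L' : ℝ := 4 * t / N with hL'
  have L4 : 1 ≤ L := by rw [hL, le_div_iff₀ hNR]; linarith
  have L4' : 1 ≤ L' := by rw [hL', le_div_iff₀ hNR]; linarith
  -- good triples
  set W : Finset (ℝ × ℝ × ℕ) := (U ×ˢ V ×ˢ Finset.range N).filter fun z =>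
    |(rk S (z.1 * F (z.2.2+1)) : ℝ) - rk S (z.1 * F z.2.2)| < L ∧
    |(rk T (z.2.1 * G (z.2.2+1)) : ℝ) - rk T (z.2.1 * G z.2.2)| < L' with hW
  have up : W.card ≤ K * (cp S L ×ˢ cp T L').card := by
    apply Finset.card_le_mul_card_image_of_maps_to
      (f := fun z : ℝ × ℝ × ℕ => ((z.1 * F z.2.2, z.1 * F (z.2.2+1)),
        (z.2.1 * G z.2.2, z.2.1 * G (z.2.2+1))))
    · rintro ⟨u, v, i⟩ hz
      simp only [hW, Finset.mem_filter, Finset.mem_product, Finset.mem_range] at hz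
      obtain ⟨⟨h1, h2, h3⟩, h4, h5⟩ := hz
      simp only [cp, Finset.mem_product, Finset.mem_filter]
      exact ⟨⟨⟨hS u h1 i h3.le, hS u h1 _ h3⟩, h4⟩, ⟨⟨hT v h2 i h3.le, hT v h2 _ h3⟩, h5⟩⟩
    · rintro ⟨⟨x, x'⟩, ⟨y, y'⟩⟩ -
      refine le_trans ?_ (hK (x' / x) (y' / y))
      apply Finset.card_le_card_of_injOn (fun z => z.2.2)
      · rintro ⟨u, v, i⟩ hz
        simp only [hW, Finset.coe_filter, Finset.mem_filter, Finset.mem_product, Finset.mem_range,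
          Set.mem_ofPred_eq, Prod.mk.injEq] at hz ⊢
        obtain ⟨⟨⟨h1, h2, h3⟩, -⟩, ⟨rfl, rfl⟩, ⟨rfl, rfl⟩⟩ := hz
        have a1 := hU u h1
        have a2 := hV v h2
        have a3 := hF0 i h3.le
        have a4 := hG0 i h3.le
        refine ⟨h3, ?_, ?_⟩ <;> field_simp
      · rintro ⟨u, v, i⟩ hz ⟨u', v', i'⟩ hz' hii
        simp only [hW, Finset.coe_filter, Finset.mem_filter, Finset.mem_product, Finset.mem_range,
          Set.mem_ofPred_eq, Prod.mk.injEq] at hz hz' hii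
        subst hii
        obtain ⟨⟨⟨h1, h2, h3⟩, -⟩, ⟨e1, -⟩, ⟨e2, -⟩⟩ := hz
        obtain ⟨-, ⟨e1', -⟩, ⟨e2', -⟩⟩ := hz'
        have := mul_right_cancel₀ (hF0 i h3.le) (e1.trans e1'.symm)
        have := mul_right_cancel₀ (hG0 i h3.le) (e2.trans e2'.symm)
        simp [*]
  have low : (U.card : ℝ) * V.card * (N / 2) ≤ W.card := by
    have e : W.card = ∑ z ∈ U ×ˢ V, ((Finset.range N).filter fun i =>
        |(rk S (z.1 * F (i+1)) : ℝ) - rk S (z.1 * F i)| < L ∧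
        |(rk T (z.2 * G (i+1)) : ℝ) - rk T (z.2 * G i)| < L').card := by
      rw [hW]
      simp only [Finset.card_filter, Finset.sum_product]
    rw [e]
    push_cast
    have : ∀ z ∈ U ×ˢ V, (N:ℝ)/2 ≤ (((Finset.range N).filter fun i =>
        |(rk S (z.1 * F (i+1)) : ℝ) - rk S (z.1 * F i)| < L ∧
        |(rk T (z.2 * G (i+1)) : ℝ) - rk T (z.2 * G i)| < L').card : ℝ) := by
      rintro ⟨u, v⟩ hz
      obtain ⟨h1, h2⟩ := Finset.mem_product.1 hz
      have b1 := seq_bad N F S u (hU _ h1) hF (hS _ h1) L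
      have b2 := seq_bad N G T v (hV _ h2) hG (hT _ h2) L'
      set B1 := (Finset.range N).filter fun i => L ≤ |(rk S (u * F (i+1)) : ℝ) - rk S (u * F i)|
      set B2 := (Finset.range N).filter fun i => L' ≤ |(rk T (v * G (i+1)) : ℝ) - rk T (v * G i)|
      have c1 : (B1.card : ℝ) ≤ N / 4 := by
        have : (N:ℝ) / 4 * L = s := by rw [hL]; field_simp
        rw [← hs, ← this] at b1
        exact le_of_mul_le_mul_right b1 (by linarith)
      have c2 : (B2.card : ℝ) ≤ N / 4 := by
        have : (N:ℝ) / 4 * L' = t := by rw [hL']; field_simp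
        rw [← ht, ← this] at b2
        exact le_of_mul_le_mul_right b2 (by linarith)
      have sub : Finset.range N ⊆ ((Finset.range N).filter fun i =>
        |(rk S (u * F (i+1)) : ℝ) - rk S (u * F i)| < L ∧
        |(rk T (v * G (i+1)) : ℝ) - rk T (v * G i)| < L') ∪ (B1 ∪ B2) := by
        intro i hi
        by_cases k1 : |(rk S (u * F (i+1)) : ℝ) - rk S (u * F i)| < L
        · by_cases k2 : |(rk T (v * G (i+1)) : ℝ) - rk T (v * G i)| < L'
          · exact Finset.mem_union_left _ (Finset.mem_filter.2 ⟨hi, k1, k2⟩)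
          · exact Finset.mem_union_right _ (Finset.mem_union_right _
              (Finset.mem_filter.2 ⟨hi, not_lt.1 k2⟩))
        · exact Finset.mem_union_right _ (Finset.mem_union_left _
              (Finset.mem_filter.2 ⟨hi, not_lt.1 k1⟩))
      have c3 := (Finset.card_le_card sub).trans ((Finset.card_union_le _ _).trans
        (Nat.add_le_add_left (Finset.card_union_le _ _) _))
      rw [Finset.card_range] at c3
      have c4 : (N:ℝ) ≤ ((Finset.range N).filter fun i =>
        |(rk S (u * F (i+1)) : ℝ) - rk S (u * F i)| < L ∧
        |(rk T (v * G (i+1)) : ℝ) - rk T (v * G i)| < L').card + (B1.card + B2.card) := by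
        exact_mod_cast c3
      simp only
      linarith
    have := Finset.card_nsmul_le_sum _ _ _ this
    rw [Finset.card_product, nsmul_eq_mul] at this
    push_cast at this
    exact this
  have p1 : ((cp S L).card : ℝ) ≤ 12 * s ^ 2 / N := by
    refine (cp_card S L (by linarith)).trans ?_
    calc (2 * L + 1) * s ≤ (3 * L) * s := by gcongr; linarith
      _ = _ := by rw [hL]; ring
  have p2 : ((cp T L').card : ℝ) ≤ 12 * t ^ 2 / N := by
    refine (cp_card T L' (by linarith)).trans ?_
    calc (2 * L' + 1) * t ≤ (3 * L') * t := by gcongr; linarith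
      _ = _ := by rw [hL']; ring
  have up' : (W.card : ℝ) ≤ K * ((cp S L).card * (cp T L').card) := by
    rw [Finset.card_product] at up
    exact_mod_cast up
  have fin : (U.card : ℝ) * V.card * (N / 2) ≤ K * ((12 * s ^ 2 / N) * (12 * t ^ 2 / N)) :=
    low.trans (up'.trans (by gcongr))
  calc (U.card : ℝ) * V.card * N ^ 3 = ((U.card : ℝ) * V.card * (N / 2)) * (2 * N ^ 2) := by ring
    _ ≤ (K * ((12 * s ^ 2 / N) * (12 * t ^ 2 / N))) * (2 * N ^ 2) := by gcongr
    _ = _ := by field_simp; ring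

theorem mono_seq (f : ℝ[X]) (N : ℕ) (a : ℕ → ℝ) (ha : ∀ i j, i < j → j ≤ N → a i < a j)
    (hf : ∀ x ∈ Set.Icc (a 0) (a N), f.derivative.eval x ≠ 0) :
    (∀ i < N, f.eval (a i) < f.eval (a (i+1))) ∨ (∀ i < N, f.eval (a (i+1)) < f.eval (a i)) := by
  have h0 : ∀ i ≤ N, a 0 ≤ a i := fun i hi => by
    rcases Nat.eq_zero_or_pos i with h | h
    · rw [h]
    · exact (ha _ _ h hi).le
  have h1 : ∀ i ≤ N, a i ≤ a N := fun i hi => by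
    rcases hi.eq_or_lt with h | h
    · rw [h]
    · exact (ha _ _ h le_rfl).le
  have inj : Set.InjOn (fun x => f.eval x) (Set.Icc (a 0) (a N)) := by
    have aux : ∀ x ∈ Set.Icc (a 0) (a N), ∀ y ∈ Set.Icc (a 0) (a N), x < y →
        f.eval x ≠ f.eval y := by
      intro x hx y hy hxy he
      obtain ⟨c, hc, hc'⟩ := exists_hasDerivAt_eq_zero (f := fun x => f.eval x)
        (f' := fun x => f.derivative.eval x) hxy f.continuous.continuousOn he
        (fun z _ => f.hasDerivAt z)
      exact hf c ⟨hx.1.trans hc.1.le, hc.2.le.trans hy.2⟩ hc'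
    intro x hx y hy he
    rcases lt_trichotomy x y with h | h | h
    · exact absurd he (aux x hx y hy h)
    · exact h
    · exact absurd he.symm (aux y hy x hx h)
  rcases ContinuousOn.strictMonoOn_of_injOn_Icc' (h0 N le_rfl) f.continuous.continuousOn inj with h | h
  · left
    exact fun i hi => h ⟨h0 i hi.le, h1 i hi.le⟩ ⟨h0 _ hi, h1 _ hi⟩ (ha _ _ (Nat.lt_succ_self i) hi)
  · right
    exact fun i hi => h ⟨h0 i hi.le, h1 i hi.le⟩ ⟨h0 _ hi, h1 _ hi⟩ (ha _ _ (Nat.lt_succ_self i) hi)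

theorem same_sign (f : ℝ[X]) (x y : ℝ) (hxy : x ≤ y) (hf : ∀ z ∈ Set.Icc x y, f.eval z ≠ 0) :
    0 < f.eval y / f.eval x := by
  have h1 := hf x ⟨le_rfl, hxy⟩
  have h2 := hf y ⟨hxy, le_rfl⟩
  by_contra hc
  have h3 := intermediate_value_Icc hxy f.continuous.continuousOn
  have h4 := intermediate_value_Icc' hxy f.continuous.continuousOn
  rcases lt_or_gt_of_ne h1 with a | a <;> rcases lt_or_gt_of_ne h2 with b | b
  · exact hc (div_pos_of_neg_of_neg b a)
  · obtain ⟨z, hz, hz'⟩ := h3 ⟨a.le, b.le⟩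
    exact hf z hz hz'
  · obtain ⟨z, hz, hz'⟩ := h4 ⟨b.le, a.le⟩
    exact hf z hz hz'
  · exact hc (div_pos b a)

theorem exists_seq (A : Finset ℝ) (N : ℕ) (h : A.card = N + 1) :
    ∃ a : ℕ → ℝ, (∀ i ≤ N, a i ∈ A) ∧ ∀ i j, i < j → j ≤ N → a i < a j := by
  refine ⟨fun i => if hi : i < N + 1 then A.orderEmbOfFin h ⟨i, hi⟩ else 0, ?_, ?_⟩
  · intro i hi
    simp only [dif_pos (Nat.lt_succ_of_le hi)]
    exact Finset.orderEmbOfFin_mem _ _ _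
  · intro i j hij hj
    simp only [dif_pos (Nat.lt_succ_of_le hj), dif_pos (hij.trans (Nat.lt_succ_of_le hj))]
    simpa using hij

theorem count_roots (N K : ℕ) (R : ℝ[X]) (hR : R ≠ 0) (hK : R.natDegree ≤ K) (a : ℕ → ℝ)
    (I : Finset ℕ) (ha : Set.InjOn a I) (h : ∀ i ∈ I, R.eval (a i) = 0) : I.card ≤ K := by
  calc I.card ≤ R.roots.toFinset.card := by
        apply Finset.card_le_card_of_injOn a _ ha
        intro i hi
        simpa [hR] using h i hi
    _ ≤ R.natDegree := (Multiset.toFinset_card_le _).trans (card_roots' _)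
    _ ≤ K := hK

theorem piece (Z A : Finset ℝ) (D : ℕ) (hZ : Z.card ≤ D) :
    ∃ A' ⊆ A, A.card ≤ (D + 1) * A'.card + D ∧
      ∀ a ∈ A', ∀ b ∈ A', ∀ x ∈ Set.Icc a b, x ∉ Z := by
  have hc : A.card ≤ (A \ Z).card + D := by
    have := Finset.le_card_sdiff Z A
    omega
  obtain ⟨k, hk⟩ : ∃ k, (A \ Z).card ≤ (D + 1) * ((A \ Z).filter fun a => rk Z a = k).card := by
    obtain ⟨k, -, hk⟩ := Finset.exists_max_image (Finset.range (D+1))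
      (fun k => ((A \ Z).filter fun a => rk Z a = k).card) ⟨0, by simp⟩
    refine ⟨k, ?_⟩
    have := Finset.card_le_mul_card_image_of_maps_to (f := rk Z) (s := A \ Z)
      (t := Finset.range (D+1)) (fun a _ => Finset.mem_range.2
        (Nat.lt_succ_of_le ((rk_le Z a).trans hZ))) _ hk
    rwa [Finset.card_range, mul_comm] at this
  refine ⟨(A \ Z).filter fun a => rk Z a = k,
    (Finset.filter_subset _ _).trans Finset.sdiff_subset, by omega, ?_⟩
  intro a ha b hb x hx hxZ
  simp only [Finset.mem_filter, Finset.mem_sdiff] at ha hb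
  have hxb : x < b := lt_of_le_of_ne hx.2 (fun h => hb.1.2 (h ▸ hxZ))
  have h1 := rk_lt Z hxZ hxb
  have h2 : rk Z a ≤ rk Z x := by
    apply Finset.card_le_card
    intro z hz
    simp only [Finset.mem_filter] at hz ⊢
    exact ⟨hz.1, hz.2.trans_le hx.1⟩
  omega

theorem image_card (p : ℝ[X]) (δ : ℕ) (hd : 0 < p.natDegree) (hp : p.natDegree ≤ δ) (B : Finset ℝ) :
    B.card ≤ δ * (((B.image fun b => p.eval b).erase 0).card + 1) := by
  have h : B.card ≤ δ * (B.image fun b => p.eval b).card := by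
    apply Finset.card_le_mul_card_image
    intro y _
    have hne : p - C y ≠ 0 := by
      intro h
      have := natDegree_sub_C (p := p) (a := y)
      rw [h, natDegree_zero] at this
      omega
    calc _ ≤ (p - C y).roots.toFinset.card := by
          apply Finset.card_le_card
          intro b hb
          simp only [Finset.mem_filter] at hb
          simp [hne, hb.2]
      _ ≤ (p - C y).natDegree := (Multiset.toFinset_card_le _).trans (card_roots' _)
      _ ≤ δ := by rw [natDegree_sub_C]; exact hp
  refine h.trans (Nat.mul_le_mul_left _ ?_)
  have := Finset.pred_card_le_card_erase (s := B.image fun b => p.eval b) (a := 0)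
  omega

theorem arith (n d u v N X : ℝ) (hd : 0 ≤ d) (hu : 0 ≤ u) (hv : 0 ≤ v) (hN : 0 ≤ N)
    (hn : 4 * (4 * d + 1) ≤ n) (h1 : n ≤ d * (u + 1)) (h2 : n ≤ d * (v + 1))
    (h3 : n ≤ (4 * d + 1) * (N + 1) + 4 * d)
    (h : u * v * N ^ 3 ≤ 288 * (2 * d * d) * X ^ 2) :
    n ^ 5 ≤ ((4 * (4 * d + 1)) ^ 5 * (288 * (2 * d * d + 1))) * X ^ 2 := by
  have n0 : 0 ≤ n := by linarith
  have u1 : n ≤ (4 * (4 * d + 1)) * u := by nlinarith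
  have v1 : n ≤ (4 * (4 * d + 1)) * v := by nlinarith
  have n1 : n ≤ (4 * (4 * d + 1)) * N := by nlinarith
  set D := 4 * (4 * d + 1) with hD
  have D0 : 0 ≤ D := by rw [hD]; positivity
  have X0 : 0 ≤ X ^ 2 := sq_nonneg X
  have t : n ^ 3 ≤ (D * N) ^ 3 := pow_le_pow_left₀ n0 n1 3
  calc n ^ 5 = n * n * n ^ 3 := by ring
    _ ≤ (D * u) * (D * v) * (D * N) ^ 3 :=
        mul_le_mul (mul_le_mul u1 v1 n0 (mul_nonneg D0 hu)) t (pow_nonneg n0 3)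
          (mul_nonneg (mul_nonneg D0 hu) (mul_nonneg D0 hv))
    _ = D ^ 5 * (u * v * N ^ 3) := by ring
    _ ≤ D ^ 5 * (288 * (2 * d * d + 1) * X ^ 2) :=
        mul_le_mul_of_nonneg_left (by nlinarith) (pow_nonneg D0 5)
    _ = _ := by ring

set_option maxHeartbeats 1000000 in
theorem core_s10 (δ : ℕ) (p₁ p₂ q₁ q₂ : ℝ[X])
    (a1 : 0 < p₁.natDegree) (a2 : 0 < p₂.natDegree) (a3 : 0 < q₁.natDegree) (a4 : 0 < q₂.natDegree)
    (b1 : p₁.natDegree ≤ δ) (b2 : p₂.natDegree ≤ δ) (b3 : q₁.natDegree ≤ δ) (b4 : q₂.natDegree ≤ δ)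
    (m1 : p₁.Monic) (m3 : q₁.Monic) (hne : ¬ EquivM p₁ q₁)
    (n : ℕ) (A B : Finset ℝ) (hA : A.card = n) (hB : B.card = n) (hn : 4 * (4 * δ + 1) ≤ n) :
    (n : ℝ) ^ 5 ≤ ((4 * (4 * δ + 1)) ^ 5 * (288 * (2 * δ * δ + 1))) *
      ((((A.image fun a => p₁.eval a) * (B.image fun b => p₂.eval b)).card : ℝ) *
            (((A.image fun a => q₁.eval a) * (B.image fun b => q₂.eval b)).card : ℝ)) ^ 2 := by
  set E : ℝ[X] := p₁ * q₁ * (derivative p₁ * derivative q₁) with hE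
  have hder : ∀ p : ℝ[X], 0 < p.natDegree → derivative p ≠ 0 := by
    intro p hp h
    have := derivative_eq_zero.1 h
    omega
  have hE0 : E ≠ 0 := mul_ne_zero (mul_ne_zero m1.ne_zero m3.ne_zero)
    (mul_ne_zero (hder _ a1) (hder _ a3))
  have hEd : E.natDegree ≤ 4 * δ := by
    have h1 := natDegree_mul_le (p := p₁ * q₁) (q := derivative p₁ * derivative q₁)
    have h2 := natDegree_mul_le (p := p₁) (q := q₁)
    have h3 := natDegree_mul_le (p := derivative p₁) (q := derivative q₁)
    have h4 := natDegree_derivative_le p₁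
    have h5 := natDegree_derivative_le q₁
    rw [← hE] at h1
    omega
  obtain ⟨A', hA', hcard, hZ⟩ := piece E.roots.toFinset A (4 * δ)
    ((Multiset.toFinset_card_le _).trans ((card_roots' _).trans hEd))
  have hZ' : ∀ a ∈ A', ∀ b ∈ A', ∀ x ∈ Set.Icc a b, p₁.eval x ≠ 0 ∧ q₁.eval x ≠ 0 ∧
      p₁.derivative.eval x ≠ 0 ∧ q₁.derivative.eval x ≠ 0 := by
    intro a ha b hb x hx
    have := hZ a ha b hb x hx
    rw [Multiset.mem_toFinset, mem_roots hE0] at this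
    simp only [IsRoot, hE, eval_mul, mul_eq_zero, not_or] at this
    tauto
  obtain ⟨N, hN⟩ : ∃ N, A'.card = N + 1 := by
    refine ⟨A'.card - 1, ?_⟩
    have : A'.card ≠ 0 := by
      intro h
      rw [h] at hcard
      omega
    omega
  obtain ⟨a, haA, ha⟩ := exists_seq A' N hN
  rw [hN, hA] at hcard
  have hN0 : 0 < N := by
    rcases Nat.eq_zero_or_pos N with h | h
    · subst h; omega
    · exact h
  have hZN := hZ' _ (haA 0 (Nat.zero_le _)) _ (haA N le_rfl)
  have hdiag := fun i hi => hZ' _ (haA i hi) _ (haA i hi) (a i) ⟨le_rfl, le_rfl⟩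
  have hinj : ∀ i ≤ N, ∀ j ≤ N, a i = a j → i = j := by
    intro i hi j hj he
    rcases lt_trichotomy i j with h | h | h
    · exact absurd he (ha _ _ h hj).ne
    · exact h
    · exact absurd he (ha _ _ h hi).ne'
  have hF := mono_seq p₁ N a ha fun x hx => (hZN x hx).2.2.1
  have hG := mono_seq q₁ N a ha fun x hx => (hZN x hx).2.2.2
  have hmain := comb N hN0 (fun i => p₁.eval (a i)) (fun i => q₁.eval (a i)) hF hG
    (fun i hi => (hdiag i hi).1) (fun i hi => (hdiag i hi).2.1)
    ((B.image fun b => p₂.eval b).erase 0) ((B.image fun b => q₂.eval b).erase 0)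
    ((A.image fun a => p₁.eval a) * (B.image fun b => p₂.eval b))
    ((A.image fun a => q₁.eval a) * (B.image fun b => q₂.eval b))
    (fun u hu => Finset.ne_of_mem_erase hu) (fun u hu => Finset.ne_of_mem_erase hu)
    (fun u hu i hi => by
      rw [mul_comm u]
      exact Finset.mul_mem_mul (Finset.mem_image_of_mem (fun a => p₁.eval a) (hA' (haA i hi)))
        (Finset.mem_of_mem_erase hu))
    (fun u hu i hi => by
      rw [mul_comm u]
      exact Finset.mul_mem_mul (Finset.mem_image_of_mem (fun a => q₁.eval a) (hA' (haA i hi)))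
        (Finset.mem_of_mem_erase hu))
    (2 * δ * δ) (by
      intro l m
      rcases Finset.eq_empty_or_nonempty ((Finset.range N).filter fun i =>
        p₁.eval (a (i+1)) = l * p₁.eval (a i) ∧ q₁.eval (a (i+1)) = m * q₁.eval (a i)) with h | ⟨i₀, hi₀⟩
      · rw [h]; simp
      simp only [Finset.mem_filter, Finset.mem_range] at hi₀
      obtain ⟨hi, e1, e2⟩ := hi₀
      have hlt := ha i₀ (i₀+1) (Nat.lt_succ_self _) hi
      have hp0 := (hdiag i₀ hi.le).1
      have hl0 : 0 < l := by
        have := same_sign p₁ _ _ hlt.le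
          (fun z hz => (hZ' _ (haA _ hi.le) _ (haA _ hi) z hz).1)
        rwa [e1, mul_div_assoc, div_self hp0, mul_one] at this
      have hm0 : m ≠ 0 := by
        rintro rfl
        rw [zero_mul] at e2
        exact (hdiag (i₀+1) hi).2.1 e2
      have hl1 : l ≠ 1 := by
        rintro rfl
        rw [one_mul] at e1
        rcases hF with h | h
        · exact (h i₀ hi).ne' e1
        · exact (h i₀ hi).ne e1
      rcases lt_or_gt_of_ne hl1 with hl | hl
      · obtain ⟨R, hR, hRd, hRz⟩ := alg δ p₁ q₁ m1 m3 a1 a3 b1 b3 hne l⁻¹ m⁻¹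
          ((one_lt_inv₀ hl0).2 hl) (inv_ne_zero hm0)
        refine count_roots N _ R hR hRd (fun i => a (i+1)) _ ?_ ?_
        · intro i hi j hj he
          simp only [Finset.coe_filter, Finset.mem_range, Set.mem_ofPred_eq] at hi hj
          have := hinj _ hi.1 _ hj.1 he
          omega
        · intro i hi
          simp only [Finset.mem_filter, Finset.mem_range] at hi
          apply hRz _ (a i)
          · rw [hi.2.1]; field_simp
          · rw [hi.2.2]; field_simp
      · obtain ⟨R, hR, hRd, hRz⟩ := alg δ p₁ q₁ m1 m3 a1 a3 b1 b3 hne l m hl hm0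
        refine count_roots N _ R hR hRd a _ ?_ ?_
        · intro i hi j hj he
          simp only [Finset.coe_filter, Finset.mem_range, Set.mem_ofPred_eq] at hi hj
          exact hinj _ hi.1.le _ hj.1.le he
        · intro i hi
          simp only [Finset.mem_filter, Finset.mem_range] at hi
          exact hRz _ _ hi.2.1 hi.2.2)
  have hU := image_card p₂ δ a2 b2 B
  have hV := image_card q₂ δ a4 b4 B
  rw [hB] at hU hV
  set U := (B.image fun b => p₂.eval b).erase 0
  set V := (B.image fun b => q₂.eval b).erase 0
  set X : ℝ := (((A.image fun a => p₁.eval a) * (B.image fun b => p₂.eval b)).card : ℝ) *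
            (((A.image fun a => q₁.eval a) * (B.image fun b => q₂.eval b)).card : ℝ)
  have hnR : (4 * (4 * (δ:ℝ) + 1)) ≤ n := by exact_mod_cast hn
  have hUR : (n:ℝ) ≤ δ * (U.card + 1) := by exact_mod_cast hU
  have hVR : (n:ℝ) ≤ δ * (V.card + 1) := by exact_mod_cast hV
  have hNR : (n:ℝ) ≤ (4 * δ + 1) * (N + 1) + 4 * δ := by exact_mod_cast hcard
  push_cast at hmain
  exact arith n δ U.card V.card N X (by positivity) (by positivity) (by positivity) (by positivity)
    hnR hUR hVR hNR hmain

theorem finish (n : ℕ) (M X : ℝ) (hM : 0 < M) (hX : 0 ≤ X) (h : (n:ℝ) ^ 5 ≤ M * X ^ 2) :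
    (1 / Real.sqrt M) * (n : ℝ) ^ ((5 : ℝ) / 2) ≤ X := by
  have e : (n : ℝ) ^ ((5 : ℝ) / 2) = Real.sqrt ((n:ℝ) ^ 5) := by
    rw [Real.sqrt_eq_rpow, ← Real.rpow_natCast, ← Real.rpow_mul (by positivity)]
    norm_num
  have hs : 0 < Real.sqrt M := Real.sqrt_pos.2 hM
  rw [e, one_div, inv_mul_le_iff₀ hs]
  calc Real.sqrt ((n:ℝ) ^ 5) ≤ Real.sqrt (M * X ^ 2) := Real.sqrt_le_sqrt h
    _ = _ := by rw [Real.sqrt_mul hM.le, Real.sqrt_sq hX]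

theorem stmt10 (δ : ℕ) :
    ∃ c : ℝ, 0 < c ∧
      ∀ p₁ p₂ q₁ q₂ : Polynomial ℝ,
        0 < p₁.natDegree → 0 < p₂.natDegree → 0 < q₁.natDegree → 0 < q₂.natDegree →
        p₁.natDegree ≤ δ → p₂.natDegree ≤ δ → q₁.natDegree ≤ δ → q₂.natDegree ≤ δ →
        p₁.Monic → p₂.Monic → q₁.Monic → q₂.Monic →
        ¬ EquivM p₁ q₁ →
        ∀ (n : ℕ) (A B : Finset ℝ), A.card = n → B.card = n →
          c * (n : ℝ) ^ ((5 : ℝ) / 2) ≤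
            (((A.image fun a => p₁.eval a) * (B.image fun b => p₂.eval b)).card : ℝ) *
            (((A.image fun a => q₁.eval a) * (B.image fun b => q₂.eval b)).card : ℝ) := by
  have hM : (0:ℝ) < ((4 * (4 * δ + 1)) ^ 5 * (288 * (2 * δ * δ + 1))) := by positivity
  refine ⟨1 / Real.sqrt ((4 * (4 * δ + 1)) ^ 5 * (288 * (2 * δ * δ + 1))),
    div_pos one_pos (Real.sqrt_pos.2 hM), ?_⟩
  intro p₁ p₂ q₁ q₂ a1 a2 a3 a4 b1 b2 b3 b4 m1 _ m3 _ hne n A B hA hB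
  refine finish n _ _ hM (by positivity) ?_
  rcases le_or_gt (4 * (4 * δ + 1)) n with hn | hn
  · exact core_s10 δ p₁ p₂ q₁ q₂ a1 a2 a3 a4 b1 b2 b3 b4 m1 m3 hne n A B hA hB hn
  · rcases Nat.eq_zero_or_pos n with h0 | h0
    · rw [h0]
      simp only [Nat.cast_zero, ne_eq, OfNat.ofNat_ne_zero, not_false_eq_true, zero_pow]
      positivity
    · have hAn : A.Nonempty := Finset.card_pos.1 (by omega)
      have hBn : B.Nonempty := Finset.card_pos.1 (by omega)
      have s1 : (1:ℝ) ≤ ((A.image fun a => p₁.eval a) * (B.image fun b => p₂.eval b)).card := by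
        exact_mod_cast Finset.card_pos.2 ((hAn.image _).mul (hBn.image _))
      have s2 : (1:ℝ) ≤ ((A.image fun a => q₁.eval a) * (B.image fun b => q₂.eval b)).card := by
        exact_mod_cast Finset.card_pos.2 ((hAn.image _).mul (hBn.image _))
      have s3 := one_le_pow₀ (one_le_mul_of_one_le_of_one_le s1 s2) (n := 2)
      have hnR : (n:ℝ) ≤ 4 * (4 * (δ:ℝ) + 1) := by exact_mod_cast hn.le
      calc (n:ℝ) ^ 5 ≤ (4 * (4 * (δ:ℝ) + 1)) ^ 5 := by gcongr
        _ = (4 * (4 * (δ:ℝ) + 1)) ^ 5 * 1 * 1 := by ring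
        _ ≤ _ := by
          gcongr
          have : (0:ℝ) ≤ 2 * δ * δ := by positivity
          linarith
end
end

section
/- Let p_1, p_2, q_1, q_2 ∈ ℝ[x] be nonconstant polynomials, each of degree at most δ. Then there exists a constant c > 0 depending only on δ such that for all n ∈ ℕ and all finite sets A, B ⊂ ℝ with |A| = |B| = n, |p_1(A) + p_2(B)| · |q_1(A) · q_2(B)| ≥ c · n^{5/2}. -/
open Polynomial Pointwise

noncomputable section

/-- Classical decidability of membership in an interval. -/
instance decidableMemUIcc (a b v : ℝ) : Decidable (v ∈ Set.uIcc a b) := Classical.dec _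

/-- Elimination polynomial. -/
lemma exists_elim (P Q : ℂ[X]) (δ : ℕ) (hP : 0 < P.natDegree) (hQ : 0 < Q.natDegree)
    (hPd : P.natDegree ≤ δ) (hQd : Q.natDegree ≤ δ) (d r : ℂ) (hd : d ≠ 0) :
    ∃ R : ℂ[X], R ≠ 0 ∧ R.natDegree ≤ 2 * δ * δ ∧
      ∀ x y, P.eval y = P.eval x + d → Q.eval y = r * Q.eval x → R.eval x = 0 := by
  set F : ℂ[X][X] := P.map C - C (P + C d) with hF
  set G : ℂ[X][X] := Q.map C - C (C r * Q) with hG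
  set R : ℂ[X] := resultant F G P.natDegree Q.natDegree with hR
  have key : ∀ x, R.eval x = P.leadingCoeff ^ Q.natDegree *
      ((P - C (P.eval x + d)).roots.map (Q - C (r * Q.eval x)).eval).prod := by
    intro x
    have h1 : R.eval x = (evalRingHom x) R := rfl
    rw [h1, hR, ← resultant_map_map]
    have hm : (evalRingHom x).comp (C : ℂ →+* ℂ[X]) = RingHom.id ℂ := by
      ext; simp
    have e1 : F.map (evalRingHom x) = P - C (P.eval x + d) := by
      simp [hF, Polynomial.map_map, hm]
    have e2 : G.map (evalRingHom x) = Q - C (r * Q.eval x) := by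
      simp [hG, Polynomial.map_map, hm]
    rw [e1, e2]
    have hdeg : (P - C (P.eval x + d)).natDegree = P.natDegree := natDegree_sub_C
    have hlc : (P - C (P.eval x + d)).leadingCoeff = P.leadingCoeff := by
      rw [leadingCoeff, hdeg, coeff_sub, coeff_C_of_ne_zero hP.ne', sub_zero, leadingCoeff]
    have := resultant_eq_prod_eval (P - C (P.eval x + d)) (Q - C (r * Q.eval x)) Q.natDegree
      (le_of_eq natDegree_sub_C) (IsAlgClosed.splits _)
    rw [hdeg, hlc] at this
    exact this
  have hPne : ∀ c, P - C c ≠ 0 := by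
    intro c h
    have : (P - C c).natDegree = P.natDegree := natDegree_sub_C
    rw [h] at this; simp at this; omega
  refine ⟨R, ?_, ?_, ?_⟩
  · intro hR0
    have step : ∀ x, ∃ y, P.eval y = P.eval x + d ∧ Q.eval y = r * Q.eval x := by
      intro x
      have := key x
      rw [hR0, eval_zero] at this
      have hlc : P.leadingCoeff ^ Q.natDegree ≠ 0 := by
        apply pow_ne_zero
        intro h
        rw [leadingCoeff_eq_zero] at h
        simp [h] at hP
      have h0 := (mul_eq_zero.1 this.symm).resolve_left hlc
      rw [Multiset.prod_eq_zero_iff, Multiset.mem_map] at h0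
      obtain ⟨y, hy, hy'⟩ := h0
      rw [mem_roots (hPne _)] at hy
      refine ⟨y, ?_, ?_⟩
      · simpa [sub_eq_zero] using hy
      · simpa [sub_eq_zero] using hy'
    choose φ hφ using step
    obtain ⟨x0, hx0⟩ := IsAlgClosed.exists_root Q (by
      intro h; rw [natDegree_pos_iff_degree_pos, h] at hQ; simp at hQ)
    have it : ∀ k : ℕ, P.eval (φ^[k] x0) = P.eval x0 + k * d ∧ Q.eval (φ^[k] x0) = 0 := by
      intro k
      induction k with
      | zero => simpa using hx0
      | succ k ih =>
        rw [Function.iterate_succ_apply']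
        refine ⟨?_, ?_⟩
        · rw [(hφ _).1, ih.1]; push_cast; ring
        · rw [(hφ _).2, ih.2]; simp
    have hQ0 : Q ≠ 0 := by rintro rfl; simp at hQ
    have hinj : Function.Injective fun k : ℕ => φ^[k] x0 := by
      intro k l hkl
      have h1 := (it k).1
      have h2 := (it l).1
      simp only at hkl
      rw [hkl, h2] at h1
      have := mul_right_cancel₀ hd (add_left_cancel h1)
      exact_mod_cast this.symm
    have hfin : (Q.roots.toFinset : Set ℂ).Finite := Finset.finite_toSet _
    exact Set.infinite_of_injective_forall_mem hinj
      (fun k => by simp [hQ0, (it k).2]) hfin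
  · have hFc : ∀ k, (F.coeff k).natDegree ≤ δ := by
      intro k
      rw [hF, coeff_sub, coeff_map, coeff_C]
      refine (natDegree_sub_le _ _).trans ?_
      split_ifs <;> simp [hPd]
    have hGc : ∀ k, (G.coeff k).natDegree ≤ δ := by
      intro k
      rw [hG, coeff_sub, coeff_map, coeff_C]
      refine (natDegree_sub_le _ _).trans ?_
      split_ifs
      · simpa using (natDegree_C_mul_le _ _).trans hQd
      · simp
    have hent : ∀ i j, (sylvester F G P.natDegree Q.natDegree i j).natDegree ≤ δ := by
      intro i j
      induction j using Fin.addCases with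
      | left j => simp only [sylvester, Matrix.of_apply, Fin.addCases_left]; split_ifs <;> simp [hGc]
      | right j => simp only [sylvester, Matrix.of_apply, Fin.addCases_right]; split_ifs <;> simp [hFc]
    rw [hR, resultant, Matrix.det_apply]
    refine natDegree_sum_le_of_forall_le _ _ ?_
    intro σ _
    refine (natDegree_smul_le _ _).trans ?_
    refine (natDegree_prod_le _ _).trans ?_
    refine (Finset.sum_le_card_nsmul _ _ δ (fun i _ => hent _ _)).trans ?_
    simp only [Finset.card_univ, Fintype.card_fin, smul_eq_mul]
    gcongr
    omega
  · intro x y h1 h2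
    rw [key]
    apply mul_eq_zero_of_right
    rw [Multiset.prod_eq_zero_iff, Multiset.mem_map]
    refine ⟨y, ?_, by simp [h2]⟩
    rw [mem_roots (hPne _)]
    simp [h1]

lemma card_eval_eq_le (p : ℝ[X]) (δ : ℕ) (hp : 0 < p.natDegree) (hpd : p.natDegree ≤ δ) (c : ℝ)
    (U : Finset ℝ) (hU : ∀ u ∈ U, p.eval u = c) : U.card ≤ δ := by
  have hdeg : (p - C c).natDegree = p.natDegree := natDegree_sub_C
  have hne : p - C c ≠ 0 := by
    intro h; rw [h] at hdeg; simp at hdeg; omega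
  have : U.val ⊆ (p - C c).roots := by
    intro u hu
    rw [mem_roots hne]
    simp [hU u hu]
  have := card_le_degree_of_subset_roots this
  omega

lemma pairs_bound (P Q : ℝ[X]) (δ : ℕ) (hP : 0 < P.natDegree) (hQ : 0 < Q.natDegree)
    (hPd : P.natDegree ≤ δ) (hQd : Q.natDegree ≤ δ) (d r : ℝ) (hd : d ≠ 0)
    (W : Finset (ℝ × ℝ))
    (hW : ∀ w ∈ W, P.eval w.2 = P.eval w.1 + d ∧ Q.eval w.2 = r * Q.eval w.1) :
    W.card ≤ δ * (2 * δ * δ) := by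
  obtain ⟨R, hR0, hRd, hR⟩ := exists_elim (P.map Complex.ofRealHom) (Q.map Complex.ofRealHom) δ
    (by simpa using hP) (by simpa using hQ) (by simpa using hPd) (by simpa using hQd)
    (d : ℂ) (r : ℂ) (by exact_mod_cast hd)
  have hev : ∀ (p : ℝ[X]) (x : ℝ), (p.map Complex.ofRealHom).eval (x : ℂ) = ((p.eval x : ℝ) : ℂ) := by
    intro p x
    have := eval_map_apply (f := Complex.ofRealHom) (p := p) x
    simpa using this
  have h1 : (W.image Prod.fst).card ≤ 2 * δ * δ := by
    have : ((W.image Prod.fst).image (fun x : ℝ => (x : ℂ))).val ⊆ R.roots := by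
      intro z hz
      rw [Finset.mem_val, Finset.mem_image] at hz
      obtain ⟨x, hx, rfl⟩ := hz
      obtain ⟨w, hw, rfl⟩ := Finset.mem_image.1 hx
      rw [mem_roots hR0]
      apply hR _ (w.2 : ℂ)
      · rw [hev, hev, (hW w hw).1]; push_cast; rfl
      · rw [hev, hev, (hW w hw).2]; push_cast; rfl
    have h2 := card_le_degree_of_subset_roots this
    rw [Finset.card_image_of_injective _ Complex.ofReal_injective] at h2
    omega
  refine (Finset.card_le_mul_card_image (f := Prod.fst) W δ ?_).trans (by gcongr)
  intro x _
  rw [← Finset.card_image_of_injOn (f := Prod.snd)]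
  · apply card_eval_eq_le P δ hP hPd (P.eval x + d)
    intro u hu
    obtain ⟨w, hw, rfl⟩ := Finset.mem_image.1 hu
    rw [Finset.mem_filter] at hw
    rw [(hW w hw.1).1, hw.2]
  · intro w hw w' hw' h
    simp only [Finset.coe_filter, Set.mem_ofPred_eq] at hw hw'
    exact Prod.ext (hw.2.trans hw'.2.symm) h

/-- Indices whose interval meets the zero set of `g`. -/
lemma card_intervals_le (g : ℝ[X]) (hg : g ≠ 0) (δ n : ℕ) (hgd : g.natDegree ≤ δ) (f : ℕ → ℝ)
    (hf : ∀ i j, i < j → j < n → f i < f j) (I : Finset ℕ)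
    (hI : ∀ i ∈ I, i + 1 < n ∧ ∃ z, f i ≤ z ∧ z ≤ f (i + 1) ∧ g.eval z = 0) :
    I.card ≤ 2 * δ := by
  have : ∀ i, ∃ z, i ∈ I → f i ≤ z ∧ z ≤ f (i + 1) ∧ g.eval z = 0 := by
    intro i
    by_cases h : i ∈ I
    · obtain ⟨_, z, hz⟩ := hI i h
      exact ⟨z, fun _ => hz⟩
    · exact ⟨0, fun h' => absurd h' h⟩
  choose ζ hζ using this
  have h1 : (I.image ζ).card ≤ δ := by
    have : (I.image ζ).val ⊆ g.roots := by
      intro z hz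
      rw [Finset.mem_val, Finset.mem_image] at hz
      obtain ⟨i, hi, rfl⟩ := hz
      rw [mem_roots hg]
      exact (hζ i hi).2.2
    exact (card_le_degree_of_subset_roots this).trans hgd
  refine (Finset.card_le_mul_card_image (f := ζ) I 2 ?_).trans (by gcongr)
  intro z _
  by_contra! hcon
  have hne : (I.filter fun i => ζ i = z).Nonempty := Finset.card_pos.1 (by omega)
  have hsub : (I.filter fun i => ζ i = z) ⊆
      {(I.filter fun i => ζ i = z).min' hne, (I.filter fun i => ζ i = z).min' hne + 1} := by
    intro j hj
    have hle := Finset.min'_le _ j hj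
    have hmem := Finset.min'_mem _ hne
    set i := (I.filter fun i => ζ i = z).min' hne
    rw [Finset.mem_filter] at hj hmem
    simp only [Finset.mem_insert, Finset.mem_singleton]
    by_contra! hc
    have hij : i + 1 < j := by omega
    have a1 := (hζ i hmem.1).2.1
    have a2 := (hζ j hj.1).1
    have a3 := hf (i+1) j hij (by have := (hI j hj.1).1; omega)
    rw [hmem.2] at a1
    rw [hj.2] at a2
    linarith
  have := (Finset.card_le_card hsub).trans Finset.card_le_two
  omega

lemma card_ivt_le (p : ℝ[X]) (δ n : ℕ) (hp : 0 < p.natDegree) (hpd : p.natDegree ≤ δ) (f : ℕ → ℝ)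
    (hf : ∀ i j, i < j → j < n → f i < f j) (v : ℝ) :
    ((Finset.range (n - 1)).filter fun i =>
      v ∈ Set.uIcc (p.eval (f i)) (p.eval (f (i + 1)))).card ≤ 2 * δ := by
  have hdeg : (p - C v).natDegree = p.natDegree := natDegree_sub_C
  have hne : p - C v ≠ 0 := by
    intro h; rw [h] at hdeg; simp at hdeg; omega
  apply card_intervals_le (p - C v) hne δ n (by omega) f hf
  intro i hi
  rw [Finset.mem_filter, Finset.mem_range] at hi
  refine ⟨by omega, ?_⟩
  have hlt := hf i (i+1) (by omega) (by omega)
  obtain ⟨z, hz, hzv⟩ := intermediate_value_uIcc (p.continuous.continuousOn) hi.2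
  rw [Set.uIcc_of_le hlt.le] at hz
  refine ⟨z, hz.1, hz.2, ?_⟩
  simp only at hzv
  simp [hzv]

lemma card_rolle_le (p : ℝ[X]) (δ n : ℕ) (hp : 0 < p.natDegree) (hpd : p.natDegree ≤ δ) (f : ℕ → ℝ)
    (hf : ∀ i j, i < j → j < n → f i < f j) :
    ((Finset.range (n - 1)).filter fun i => p.eval (f i) = p.eval (f (i + 1))).card ≤ 2 * δ := by
  have hne : derivative p ≠ 0 := by
    intro h
    have := derivative_eq_zero.1 h
    omega
  apply card_intervals_le (derivative p) hne δ n ((natDegree_derivative_le p).trans (by omega)) f hf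
  intro i hi
  rw [Finset.mem_filter, Finset.mem_range] at hi
  refine ⟨by omega, ?_⟩
  have hlt := hf i (i+1) (by omega) (by omega)
  obtain ⟨z, hz, hzv⟩ := exists_deriv_eq_zero hlt (p.continuous.continuousOn) hi.2
  refine ⟨z, hz.1.le, hz.2.le, ?_⟩
  simpa using hzv

/-- Few indices make a big jump in `S`. -/
lemma card_big_jump (p : ℝ[X]) (δ n : ℕ) (hp : 0 < p.natDegree) (hpd : p.natDegree ≤ δ) (f : ℕ → ℝ)
    (hf : ∀ i j, i < j → j < n → f i < f j) (S : Finset ℝ) (hS : S.Nonempty) :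
    4 * ((Finset.range (n - 1)).filter fun i =>
      8 * δ * S.card < n * (S.filter fun v => v ∈ Set.uIcc (p.eval (f i)) (p.eval (f (i + 1)))).card).card
      ≤ n := by
  set J := (Finset.range (n - 1)).filter fun i =>
      8 * δ * S.card < n * (S.filter fun v => v ∈ Set.uIcc (p.eval (f i)) (p.eval (f (i + 1)))).card
      with hJ
  have h1 : J.card * (8 * δ * S.card) ≤
      n * ∑ i ∈ J, (S.filter fun v => v ∈ Set.uIcc (p.eval (f i)) (p.eval (f (i + 1)))).card := by
    rw [Finset.mul_sum, ← smul_eq_mul]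
    apply Finset.card_nsmul_le_sum
    intro i hi
    rw [hJ, Finset.mem_filter] at hi
    exact hi.2.le
  have h2 : ∑ i ∈ J, (S.filter fun v => v ∈ Set.uIcc (p.eval (f i)) (p.eval (f (i + 1)))).card
      ≤ S.card * (2 * δ) := by
    have := Finset.sum_card_bipartiteAbove_eq_sum_card_bipartiteBelow (s := J) (t := S)
      (fun i v => v ∈ Set.uIcc (p.eval (f i)) (p.eval (f (i + 1))))
    unfold Finset.bipartiteAbove Finset.bipartiteBelow at this
    rw [this, ← smul_eq_mul]
    apply Finset.sum_le_card_nsmul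
    intro v _
    refine le_trans (Finset.card_le_card ?_) (card_ivt_le p δ n hp hpd f hf v)
    apply Finset.filter_subset_filter
    exact Finset.filter_subset _ _
  have hpos : 0 < 2 * δ * S.card := by
    have := hS.card_pos
    have : 0 < δ := by omega
    positivity
  have h3 : (4 * J.card) * (2 * δ * S.card) ≤ n * (2 * δ * S.card) := by
    calc _ = J.card * (8 * δ * S.card) := by ring
      _ ≤ _ := h1
      _ ≤ n * (S.card * (2 * δ)) := by gcongr
      _ = _ := by ring
  exact Nat.le_of_mul_le_mul_right h3 hpos

/-- Close pairs. -/
def nearPairs (S : Finset ℝ) (n k : ℕ) : Finset (ℝ × ℝ) :=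
  (S ×ˢ S).filter fun w => n * (S.filter fun v => v ∈ Set.uIcc w.1 w.2).card ≤ k

lemma card_nearPairs (S : Finset ℝ) (n k : ℕ) : n * (nearPairs S n k).card ≤ S.card * (2 * k) := by
  have side : ∀ s, n * (S.filter fun s' => s ≤ s' ∧
      n * (S.filter fun v => v ∈ Set.uIcc s s').card ≤ k).card ≤ k := by
    intro s
    set U := S.filter fun s' => s ≤ s' ∧ n * (S.filter fun v => v ∈ Set.uIcc s s').card ≤ k with hU
    rcases U.eq_empty_or_nonempty with h | h
    · simp [h]
    · have hm := Finset.max'_mem U h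
      set u := U.max' h with hu
      have hm' := hm
      rw [hU, Finset.mem_filter] at hm'
      refine le_trans ?_ hm'.2.2
      gcongr
      intro v hv
      have hle : v ≤ u := Finset.le_max' U v hv
      rw [hU, Finset.mem_filter] at hv
      rw [Finset.mem_filter, Set.uIcc_of_le hm'.2.1]
      exact ⟨hv.1, hv.2.1, hle⟩
  have side' : ∀ s, n * (S.filter fun s' => s' ≤ s ∧
      n * (S.filter fun v => v ∈ Set.uIcc s s').card ≤ k).card ≤ k := by
    intro s
    set U := S.filter fun s' => s' ≤ s ∧ n * (S.filter fun v => v ∈ Set.uIcc s s').card ≤ k with hU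
    rcases U.eq_empty_or_nonempty with h | h
    · simp [h]
    · have hm := Finset.min'_mem U h
      set u := U.min' h with hu
      have hm' := hm
      rw [hU, Finset.mem_filter] at hm'
      refine le_trans ?_ hm'.2.2
      gcongr
      intro v hv
      have hle : u ≤ v := Finset.min'_le U v hv
      rw [hU, Finset.mem_filter] at hv
      rw [Finset.mem_filter, Set.uIcc_of_ge hm'.2.1]
      exact ⟨hv.1, hle, hv.2.1⟩
  have h1 : (nearPairs S n k).card = ∑ s ∈ S, (S.filter fun s' =>
      n * (S.filter fun v => v ∈ Set.uIcc s s').card ≤ k).card := by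
    unfold nearPairs
    rw [Finset.card_filter, Finset.sum_product]
    simp only [Finset.card_filter]
  rw [h1, Finset.mul_sum, ← smul_eq_mul]
  apply Finset.sum_le_card_nsmul
  intro s _
  have hsub : (S.filter fun s' => n * (S.filter fun v => v ∈ Set.uIcc s s').card ≤ k) ⊆
      (S.filter fun s' => s ≤ s' ∧ n * (S.filter fun v => v ∈ Set.uIcc s s').card ≤ k) ∪
      (S.filter fun s' => s' ≤ s ∧ n * (S.filter fun v => v ∈ Set.uIcc s s').card ≤ k) := by
    intro v hv
    rw [Finset.mem_filter] at hv
    rw [Finset.mem_union, Finset.mem_filter, Finset.mem_filter]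
    rcases le_total s v with h | h
    · exact Or.inl ⟨hv.1, h, hv.2⟩
    · exact Or.inr ⟨hv.1, h, hv.2⟩
  have h2 := (Finset.card_le_card hsub).trans (Finset.card_union_le _ _)
  have h3 := Nat.mul_le_mul_left n h2
  have := side s
  have := side' s
  rw [mul_add] at h3
  omega

lemma main_big (δ n : ℕ) (p₁ p₂ q₁ q₂ : ℝ[X])
    (hp₁ : 0 < p₁.natDegree) (hp₂ : 0 < p₂.natDegree) (hq₁ : 0 < q₁.natDegree)
    (hq₂ : 0 < q₂.natDegree) (dp₁ : p₁.natDegree ≤ δ) (dp₂ : p₂.natDegree ≤ δ)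
    (dq₁ : q₁.natDegree ≤ δ) (dq₂ : q₂.natDegree ≤ δ)
    (A S T : Finset ℝ) (f : ℕ → ℝ) (hf : ∀ i j, i < j → j < n → f i < f j)
    (hA : A.card = n) (hn : 4 + 16 * δ ≤ n)
    (hS : ∀ a ∈ A, ∀ i < n, p₁.eval a + p₂.eval (f i) ∈ S)
    (hT : ∀ a ∈ A, ∀ i < n, q₁.eval a * q₂.eval (f i) ∈ T) :
    n ^ 5 ≤ 4096 * δ ^ 7 * (S.card * T.card) ^ 2 := by
  obtain ⟨a0, ha0⟩ : A.Nonempty := Finset.card_pos.1 (by omega)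
  have hSne : S.Nonempty := ⟨_, hS a0 ha0 0 (by omega)⟩
  have hTne : T.Nonempty := ⟨_, hT a0 ha0 0 (by omega)⟩
  set A' := A.filter fun a => q₁.eval a ≠ 0 with hA'
  have hA'card : n ≤ 2 * A'.card := by
    have h1 := Finset.card_filter_add_card_filter_not (s := A) (fun a => q₁.eval a = 0)
    have h2 := card_eval_eq_le q₁ δ hq₁ dq₁ 0 (A.filter fun a => q₁.eval a = 0)
      (fun u hu => (Finset.mem_filter.1 hu).2)
    have h3 : A'.card = (A.filter fun a => ¬ q₁.eval a = 0).card := rfl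
    omega
  set N := nearPairs S n (8 * δ * S.card) with hN
  set K := nearPairs T n (8 * δ * T.card) with hK
  let Good : ℝ × ℝ → ℕ → Prop := fun w i =>
    p₂.eval (f i) ≠ p₂.eval (f (i + 1)) ∧ q₂.eval (f i) ≠ 0 ∧
    (p₁.eval w.1 + p₂.eval (f i), p₁.eval w.1 + p₂.eval (f (i + 1))) ∈ N ∧
    (q₁.eval w.2 * q₂.eval (f i), q₁.eval w.2 * q₂.eval (f (i + 1))) ∈ K
  classical
  have good_count : ∀ w ∈ A ×ˢ A', n ≤ 4 * ((Finset.range (n - 1)).filter (Good w)).card := by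
    rintro ⟨a, a'⟩ hw
    rw [Finset.mem_product, hA', Finset.mem_filter] at hw
    obtain ⟨ha, ha', hq0⟩ := hw
    simp only at ha ha' hq0
    have dP : (C (p₁.eval a) + p₂).natDegree = p₂.natDegree := natDegree_C_add
    have dQ : (C (q₁.eval a') * q₂).natDegree = q₂.natDegree := natDegree_C_mul hq0
    have b1 := card_rolle_le p₂ δ n hp₂ dp₂ f hf
    have b2 : ((Finset.range (n - 1)).filter fun i => q₂.eval (f i) = 0).card ≤ 2 * δ := by
      apply card_intervals_le q₂ (by rintro rfl; simp at hq₂) δ n dq₂ f hf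
      intro i hi
      rw [Finset.mem_filter, Finset.mem_range] at hi
      exact ⟨by omega, f i, le_rfl, (hf i (i+1) (by omega) (by omega)).le, hi.2⟩
    have b3 := card_big_jump (C (p₁.eval a) + p₂) δ n (by omega) (by omega) f hf S hSne
    have b4 := card_big_jump (C (q₁.eval a') * q₂) δ n (by omega) (by omega) f hf T hTne
    simp only [eval_add, eval_mul, eval_C] at b3 b4
    have hsub : Finset.range (n - 1) ⊆ (Finset.range (n - 1)).filter (Good (a, a')) ∪
        (((Finset.range (n - 1)).filter fun i => p₂.eval (f i) = p₂.eval (f (i + 1))) ∪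
        (((Finset.range (n - 1)).filter fun i => q₂.eval (f i) = 0) ∪
        (((Finset.range (n - 1)).filter fun i => 8 * δ * S.card < n * (S.filter fun v =>
          v ∈ Set.uIcc (p₁.eval a + p₂.eval (f i)) (p₁.eval a + p₂.eval (f (i + 1)))).card) ∪
        ((Finset.range (n - 1)).filter fun i => 8 * δ * T.card < n * (T.filter fun v =>
          v ∈ Set.uIcc (q₁.eval a' * q₂.eval (f i)) (q₁.eval a' * q₂.eval (f (i + 1)))).card)))) := by
      intro i hi
      have hi' := Finset.mem_range.1 hi
      simp only [Finset.mem_union, Finset.mem_filter, hi, true_and]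
      by_contra! hc
      obtain ⟨c0, c1, c2, c3, c4⟩ := hc
      apply c0
      refine ⟨c1, c2, ?_, ?_⟩
      · rw [hN, nearPairs, Finset.mem_filter, Finset.mem_product]
        exact ⟨⟨hS a ha i (by omega), hS a ha (i+1) (by omega)⟩, c3⟩
      · rw [hK, nearPairs, Finset.mem_filter, Finset.mem_product]
        exact ⟨⟨hT a' ha' i (by omega), hT a' ha' (i+1) (by omega)⟩, c4⟩
    have hc := Finset.card_le_card hsub
    rw [Finset.card_range] at hc
    have u1 := hc.trans (Finset.card_union_le _ _)
    have u2 := u1.trans (Nat.add_le_add_left (Finset.card_union_le _ _) _)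
    have u3 := u2.trans (Nat.add_le_add_left (Nat.add_le_add_left (Finset.card_union_le _ _) _) _)
    have u4 := u3.trans (Nat.add_le_add_left (Nat.add_le_add_left (Nat.add_le_add_left
      (Finset.card_union_le _ _) _) _) _)
    omega
  set G := ((A ×ˢ A') ×ˢ Finset.range (n - 1)).filter (fun z => Good z.1 z.2) with hG
  have hGcard : n ^ 3 ≤ 8 * G.card := by
    have h1 : G.card = ∑ w ∈ A ×ˢ A', ((Finset.range (n - 1)).filter (Good w)).card := by
      rw [hG, Finset.card_filter, Finset.sum_product]
      simp only [Finset.card_filter]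
    have h2 : (A ×ˢ A').card * n ≤ 4 * G.card := by
      rw [h1, Finset.mul_sum, ← smul_eq_mul]
      exact Finset.card_nsmul_le_sum _ _ _ good_count
    rw [Finset.card_product, hA] at h2
    calc n ^ 3 = n * n * n := by ring
      _ ≤ n * (2 * A'.card) * n := by gcongr
      _ = 2 * (n * A'.card * n) := by ring
      _ ≤ 2 * (4 * G.card) := by gcongr
      _ = _ := by ring
  let Φ : (ℝ × ℝ) × ℕ → (ℝ × ℝ) × (ℝ × ℝ) := fun z =>
    ((p₁.eval z.1.1 + p₂.eval (f z.2), p₁.eval z.1.1 + p₂.eval (f (z.2 + 1))),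
     (q₁.eval z.1.2 * q₂.eval (f z.2), q₁.eval z.1.2 * q₂.eval (f (z.2 + 1))))
  have hmaps : ∀ z ∈ G, Φ z ∈ N ×ˢ K := by
    intro z hz
    rw [hG, Finset.mem_filter] at hz
    exact Finset.mem_product.2 ⟨hz.2.2.2.1, hz.2.2.2.2⟩
  have hfib : ∀ w ∈ N ×ˢ K, (G.filter fun z => Φ z = w).card ≤ 2 * δ ^ 5 := by
    rintro ⟨⟨s, s'⟩, ⟨t, t'⟩⟩ _
    rcases (G.filter fun z => Φ z = ((s, s'), (t, t'))).eq_empty_or_nonempty with h | h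
    · rw [h]; simp
    have info : ∀ z ∈ G.filter fun z => Φ z = ((s, s'), (t, t')),
        z.1.1 ∈ A ∧ z.1.2 ∈ A ∧ q₁.eval z.1.2 ≠ 0 ∧ z.2 < n - 1 ∧
        p₂.eval (f z.2) ≠ p₂.eval (f (z.2 + 1)) ∧ q₂.eval (f z.2) ≠ 0 ∧
        p₁.eval z.1.1 + p₂.eval (f z.2) = s ∧ p₁.eval z.1.1 + p₂.eval (f (z.2 + 1)) = s' ∧
        q₁.eval z.1.2 * q₂.eval (f z.2) = t ∧ q₁.eval z.1.2 * q₂.eval (f (z.2 + 1)) = t' := by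
      intro z hz
      rw [Finset.mem_filter, hG, Finset.mem_filter, Finset.mem_product, Finset.mem_product, hA',
        Finset.mem_filter, Finset.mem_range] at hz
      obtain ⟨⟨⟨⟨h1, h2, h3⟩, h4⟩, h5, h6, _⟩, h7⟩ := hz
      simp only [Φ, Prod.mk.injEq] at h7
      exact ⟨h1, h2, h3, h4, h5, h6, h7.1.1, h7.1.2, h7.2.1, h7.2.2⟩
    set H := G.filter fun z => Φ z = ((s, s'), (t, t')) with hH
    have hd : s' - s ≠ 0 := by
      obtain ⟨z, hz⟩ := h
      obtain ⟨_, _, _, _, h5, _, h7, h8, _, _⟩ := info z hz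
      intro h0
      apply h5
      linarith
    have himg : (H.image fun z => (f z.2, f (z.2 + 1))).card ≤ δ * (2 * δ * δ) := by
      apply pairs_bound p₂ q₂ δ hp₂ hq₂ dp₂ dq₂ (s' - s) (t' / t) hd
      intro w hw
      obtain ⟨z, hz, rfl⟩ := Finset.mem_image.1 hw
      obtain ⟨_, _, h3, _, h5, h6, h7, h8, h9, h10⟩ := info z hz
      refine ⟨by simp only; linarith, ?_⟩
      simp only
      rw [← h9, ← h10]
      field_simp
    have hle : H.card ≤ (δ * δ) * (H.image fun z => (f z.2, f (z.2 + 1))).card := by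
      apply Finset.card_le_mul_card_image
      rintro ⟨x, y⟩ _
      rw [← Finset.card_image_of_injOn (f := Prod.fst)]
      · have hsub : (H.filter fun z => (f z.2, f (z.2 + 1)) = (x, y)).image Prod.fst ⊆
            (A.filter fun a => p₁.eval a = s - p₂.eval x) ×ˢ
            (A.filter fun a => q₁.eval a = t / q₂.eval x) := by
          intro w hw
          obtain ⟨z, hz, rfl⟩ := Finset.mem_image.1 hw
          rw [Finset.mem_filter] at hz
          obtain ⟨h1, h2, h3, _, h5, h6, h7, h8, h9, h10⟩ := info z hz.1
          have hx : f z.2 = x := (Prod.mk.inj hz.2).1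
          rw [hx] at h6 h7 h9
          rw [Finset.mem_product, Finset.mem_filter, Finset.mem_filter]
          refine ⟨⟨h1, by linarith⟩, h2, ?_⟩
          rw [← h9]
          field_simp
        refine (Finset.card_le_card hsub).trans ?_
        rw [Finset.card_product]
        exact Nat.mul_le_mul
          (card_eval_eq_le p₁ δ hp₁ dp₁ _ _ (fun u hu => (Finset.mem_filter.1 hu).2))
          (card_eval_eq_le q₁ δ hq₁ dq₁ _ _ (fun u hu => (Finset.mem_filter.1 hu).2))
      · intro z hz z' hz' hzz
        have hz := Finset.mem_filter.1 (Finset.mem_coe.1 hz)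
        have hz' := Finset.mem_filter.1 (Finset.mem_coe.1 hz')
        refine Prod.ext hzz ?_
        have e1 : f z.2 = f z'.2 := (Prod.mk.inj hz.2).1.trans (Prod.mk.inj hz'.2).1.symm
        have l1 := (info z hz.1).2.2.2.1
        have l2 := (info z' hz'.1).2.2.2.1
        rcases lt_trichotomy z.2 z'.2 with hlt | heq | hgt
        · exact absurd e1 (hf _ _ hlt (by omega)).ne
        · exact heq
        · exact absurd e1 (hf _ _ hgt (by omega)).ne'
    calc H.card ≤ _ := hle
      _ ≤ (δ * δ) * (δ * (2 * δ * δ)) := by gcongr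
      _ = _ := by ring
  have hfin := Finset.card_le_mul_card_image_of_maps_to hmaps _ hfib
  rw [Finset.card_product] at hfin
  have hN' := card_nearPairs S n (8 * δ * S.card)
  have hK' := card_nearPairs T n (8 * δ * T.card)
  rw [← hN] at hN'
  rw [← hK] at hK'
  calc n ^ 5 = n ^ 3 * n ^ 2 := by ring
    _ ≤ (8 * (2 * δ ^ 5 * (N.card * K.card))) * n ^ 2 := by
      gcongr
      exact hGcard.trans (by gcongr)
    _ = 16 * δ ^ 5 * ((n * N.card) * (n * K.card)) := by ring
    _ ≤ 16 * δ ^ 5 * ((S.card * (2 * (8 * δ * S.card))) * (T.card * (2 * (8 * δ * T.card)))) := by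
      gcongr
    _ = _ := by ring

theorem stmt11 (δ : ℕ) :
    ∃ c : ℝ, 0 < c ∧
      ∀ p₁ p₂ q₁ q₂ : Polynomial ℝ,
        0 < p₁.natDegree → 0 < p₂.natDegree → 0 < q₁.natDegree → 0 < q₂.natDegree →
        p₁.natDegree ≤ δ → p₂.natDegree ≤ δ → q₁.natDegree ≤ δ → q₂.natDegree ≤ δ →
        ∀ (n : ℕ) (A B : Finset ℝ), A.card = n → B.card = n →
          c * (n : ℝ) ^ ((5 : ℝ) / 2) ≤
            (((A.image fun a => p₁.eval a) + (B.image fun b => p₂.eval b)).card : ℝ) *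
            (((A.image fun a => q₁.eval a) * (B.image fun b => q₂.eval b)).card : ℝ) := by
  set D : ℕ := 4096 * δ ^ 7 + (4 + 16 * δ) ^ 5 with hD
  have hDpos : (0 : ℝ) < D := by
    have : 0 < D := by positivity
    exact_mod_cast this
  refine ⟨(Real.sqrt D)⁻¹, by positivity, ?_⟩
  intro p₁ p₂ q₁ q₂ hp₁ hp₂ hq₁ hq₂ dp₁ dp₂ dq₁ dq₂ n A B hA hB
  set S := (A.image fun a => p₁.eval a) + (B.image fun b => p₂.eval b) with hS
  set T := (A.image fun a => q₁.eval a) * (B.image fun b => q₂.eval b) with hT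
  have hSm : ∀ a ∈ A, ∀ b ∈ B, p₁.eval a + p₂.eval b ∈ S := fun a ha b hb =>
    Finset.add_mem_add (Finset.mem_image_of_mem _ ha) (Finset.mem_image_of_mem _ hb)
  have hTm : ∀ a ∈ A, ∀ b ∈ B, q₁.eval a * q₂.eval b ∈ T := fun a ha b hb =>
    Finset.mul_mem_mul (Finset.mem_image_of_mem _ ha) (Finset.mem_image_of_mem _ hb)
  have key : n ^ 5 ≤ D * (S.card * T.card) ^ 2 := by
    rcases Nat.eq_zero_or_pos n with h0 | hpos
    · simp [h0]
    rcases lt_or_ge n (4 + 16 * δ) with hlt | hge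
    · obtain ⟨a, ha⟩ : A.Nonempty := Finset.card_pos.1 (by omega)
      obtain ⟨b, hb⟩ : B.Nonempty := Finset.card_pos.1 (by omega)
      have h1 : 0 < S.card := Finset.card_pos.2 ⟨_, hSm a ha b hb⟩
      have h2 : 0 < T.card := Finset.card_pos.2 ⟨_, hTm a ha b hb⟩
      have h3 : 1 ≤ (S.card * T.card) ^ 2 := Nat.one_le_iff_ne_zero.2 (by positivity)
      calc n ^ 5 ≤ (4 + 16 * δ) ^ 5 := by gcongr
        _ ≤ D * 1 := by omega
        _ ≤ _ := by gcongr
    · let e := B.orderEmbOfFin hB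
      let f : ℕ → ℝ := fun i => if h : i < n then e ⟨i, h⟩ else 0
      have hfB : ∀ i < n, f i ∈ B := by
        intro i hi
        simp only [f, hi, dif_pos]
        exact Finset.orderEmbOfFin_mem B hB _
      have hf : ∀ i j, i < j → j < n → f i < f j := by
        intro i j hij hj
        have hi : i < n := by omega
        simp only [f, hi, hj, dif_pos]
        exact e.strictMono (by simpa using hij)
      refine (main_big δ n p₁ p₂ q₁ q₂ hp₁ hp₂ hq₁ hq₂ dp₁ dp₂ dq₁ dq₂ A S T f hf hA hge
        (fun a ha i hi => hSm a ha _ (hfB i hi)) (fun a ha i hi => hTm a ha _ (hfB i hi))).trans ?_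
      gcongr
      omega
  have key' : (n : ℝ) ^ 5 ≤ D * ((S.card : ℝ) * T.card) ^ 2 := by exact_mod_cast key
  have hpow : (n : ℝ) ^ ((5 : ℝ) / 2) = Real.sqrt ((n : ℝ) ^ 5) := by
    rw [Real.sqrt_eq_rpow, ← Real.rpow_natCast, ← Real.rpow_mul (Nat.cast_nonneg n)]
    norm_num
  rw [hpow, inv_mul_le_iff₀ (Real.sqrt_pos.2 hDpos)]
  calc Real.sqrt ((n : ℝ) ^ 5) ≤ Real.sqrt (D * ((S.card : ℝ) * T.card) ^ 2) :=
        Real.sqrt_le_sqrt key'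
    _ = _ := by
      rw [Real.sqrt_mul hDpos.le, Real.sqrt_sq (by positivity)]
end
end
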